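/- arXiv:0812.2793 — 2 statements merged into one kernel-verified Lean document; each statement's English description precedes it below -/
import Mathlib

section
/- Let D ⊆ ℂ^n be a ℂ-convex domain containing no complex affine line. Then for every z ∈ D, 1/(16π)^n ≤ K_D(z)·p_D(z)² ≤ (2n)!/(2π)^n, where p_D(z) = d_{1,D}(z)···d_{n,D}(z). -/
open Complex Metric Set MeasureTheory

noncomputable section

/-- `ℂ^n` with the Euclidean (Hermitian) structure. -/
abbrev Cn (n : ℕ) := EuclideanSpace ℂ (Fin n)

instance (n : ℕ) : MeasurableSpace (Cn n) := borel _
instance (n : ℕ) : BorelSpace (Cn n) := ⟨rfl⟩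

/-- The complex affine line through `z` in direction `X`. -/
def cline {n : ℕ} (z X : Cn n) : Set (Cn n) := {w | ∃ l : ℂ, w = z + l • X}

/-- A domain: a nonempty connected open set. -/
def IsDomain' {n : ℕ} (D : Set (Cn n)) : Prop := IsOpen D ∧ IsConnected D

/-- `D` is ℂ-convex: its intersection with every complex affine line is, when
nonempty, connected and simply connected. -/
def IsCConvex {n : ℕ} (D : Set (Cn n)) : Prop :=
  ∀ z X : Cn n, X ≠ 0 → (D ∩ cline z X).Nonempty →
    IsConnected (D ∩ cline z X) ∧ SimplyConnectedSpace ↥(D ∩ cline z X)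

/-- The Carathéodory metric `γ_D(z;X)`. -/
def caraMetric {n : ℕ} (D : Set (Cn n)) (z X : Cn n) : ℝ :=
  sSup {r : ℝ | ∃ f : Cn n → ℂ, DifferentiableOn ℂ f D ∧ MapsTo f D (ball (0:ℂ) 1) ∧
    f z = 0 ∧ r = ‖fderiv ℂ f z X‖}

/-- The Kobayashi metric `κ_D(z;X)`. -/
def kobMetric {n : ℕ} (D : Set (Cn n)) (z X : Cn n) : ℝ :=
  sInf {a : ℝ | 0 ≤ a ∧ ∃ φ : ℂ → Cn n, DifferentiableOn ℂ φ (ball (0:ℂ) 1) ∧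
    MapsTo φ (ball (0:ℂ) 1) D ∧ φ 0 = z ∧ a • (fderiv ℂ φ 0 1) = X}

/-- The distance `d_D(z,X)` from `z` to `∂D` in direction `X`. -/
def dirDist {n : ℕ} (D : Set (Cn n)) (z X : Cn n) : ℝ :=
  sSup {r : ℝ | 0 < r ∧ ∀ l : ℂ, ‖l‖ < r → z + l • X ∈ D}

/-- The Euclidean distance `d_D(z)` from `z` to `∂D`. -/
def bdist {n : ℕ} (D : Set (Cn n)) (z : Cn n) : ℝ := Metric.infDist z (frontier D)

/-- `L_a`: the set of vectors `X` such that a disc `{a + λX : |λ| < ε}` lies in `∂D`. -/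
def La {n : ℕ} (D : Set (Cn n)) (a : Cn n) : Set (Cn n) :=
  {X | ∃ ε > (0:ℝ), ∀ l : ℂ, ‖l‖ < ε → a + l • X ∈ frontier D}

/-- `D` contains no complex affine line. -/
def NoComplexLine {n : ℕ} (D : Set (Cn n)) : Prop :=
  ¬ ∃ z X : Cn n, X ≠ 0 ∧ cline z X ⊆ D

/-- The Bergman kernel `K_D(z)` (restricted to the diagonal). -/
def bergmanKernel {n : ℕ} (D : Set (Cn n)) (z : Cn n) : ℝ :=
  sSup {r : ℝ | ∃ f : Cn n → ℂ, DifferentiableOn ℂ f D ∧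
    IntegrableOn (fun w => ‖f w‖ ^ 2) D ∧ (∫ w in D, ‖f w‖ ^ 2) ≤ 1 ∧ r = ‖f z‖ ^ 2}

/-- `M_D(z;X)`. -/
def bergmanM {n : ℕ} (D : Set (Cn n)) (z X : Cn n) : ℝ :=
  sSup {r : ℝ | ∃ f : Cn n → ℂ, DifferentiableOn ℂ f D ∧
    IntegrableOn (fun w => ‖f w‖ ^ 2) D ∧ (∫ w in D, ‖f w‖ ^ 2) = 1 ∧
    f z = 0 ∧ r = ‖fderiv ℂ f z X‖}

/-- The Bergman metric `B_D(z;X) = M_D(z;X)/√K_D(z)`. -/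
def bergmanMetric {n : ℕ} (D : Set (Cn n)) (z X : Cn n) : ℝ :=
  bergmanM D z X / Real.sqrt (bergmanKernel D z)

/-- `G` is weakly linearly convex: through every boundary point there is a complex
affine hyperplane missing `G`. -/
def WeaklyLinConvex {n : ℕ} (G : Set (Cn n)) : Prop :=
  ∀ a ∈ frontier G, ∃ ℓ : Cn n →L[ℂ] ℂ, ℓ ≠ 0 ∧ ∀ z ∈ G, ℓ z ≠ ℓ a

/-- `d_{j,D}(z)` from the minimal-distance construction: the distance from `z` to the
boundary of the slice of `D` by the affine subspace `z + span{v_i : i ≥ j}`. -/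
def sliceDist {n : ℕ} (D : Set (Cn n)) (z : Cn n) (v : Fin n → Cn n) (j : Fin n) : ℝ :=
  sSup {r : ℝ | 0 < r ∧
    ∀ w ∈ Submodule.span ℂ (v '' {i | j ≤ i}), ‖w‖ < r → z + w ∈ D}

/-- The data `(v j)` is an admissible output of the minimal-distance construction at `z`:
the directions are orthonormal and each `v j` realizes the distance `d_{j,D}(z)` to the
boundary of the corresponding slice. -/
def MinimalBasis {n : ℕ} (D : Set (Cn n)) (z : Cn n) (v : Fin n → Cn n) : Prop :=
  Orthonormal ℂ v ∧ ∀ j : Fin n, z + (sliceDist D z v j) • v j ∉ D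


open scoped Topology ENNReal

/-- Two logarithms of the same number that are close to each other agree. -/
lemma eq_of_exp_eq_of_norm_sub_lt {a b : ℂ} (h : exp a = exp b) (hab : ‖a - b‖ < 1) : a = b := by
  obtain ⟨k, hk⟩ := Complex.exp_eq_exp_iff_exists_int.1 h
  have h1 : ‖a - b‖ = |(k : ℝ)| * (2 * Real.pi) := by
    rw [hk]
    simp [abs_of_pos Real.pi_pos]
  have hk0 : k = 0 := by
    by_contra hne
    have : (1 : ℝ) ≤ |(k : ℝ)| := by exact_mod_cast Int.one_le_abs hne
    nlinarith [Real.pi_gt_three]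
  simpa [hk0] using hk

/-- Continuous logarithms on a preconnected set are determined by one value. -/
lemma eqOn_of_exp_eqOn {X : Type*} [TopologicalSpace X] {S : Set X} (hS : IsPreconnected S)
    {g₁ g₂ : X → ℂ} (h₁ : ContinuousOn g₁ S) (h₂ : ContinuousOn g₂ S)
    (he : ∀ x ∈ S, exp (g₁ x) = exp (g₂ x)) {a : X} (ha : a ∈ S) (hga : g₁ a = g₂ a) :
    ∀ x ∈ S, g₁ x = g₂ x := by
  have := isPreconnected_iff_preconnectedSpace.1 hS
  have hc : Continuous fun x : S => g₁ x - g₂ x :=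
    (continuousOn_iff_continuous_domRestrict.1 h₁).sub (continuousOn_iff_continuous_domRestrict.1 h₂)
  have hclopen : IsClopen {x : S | g₁ x - g₂ x = 0} := by
    refine ⟨isClosed_eq hc continuous_const, ?_⟩
    have : {x : S | g₁ x - g₂ x = 0} = {x : S | ‖g₁ x - g₂ x‖ < 1} := by
      ext x
      constructor
      · intro h
        change g₁ x - g₂ x = 0 at h
        change ‖g₁ x - g₂ x‖ < 1
        rw [h]; simp
      · intro h
        exact sub_eq_zero.2 (eq_of_exp_eq_of_norm_sub_lt (he x x.2) h)
    rw [this]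
    exact isOpen_lt hc.norm continuous_const
  have huniv := hclopen.eq_univ ⟨⟨a, ha⟩, sub_eq_zero.2 hga⟩
  intro x hx
  have : (⟨x, hx⟩ : S) ∈ {x : S | g₁ x - g₂ x = 0} := by rw [huniv]; trivial
  exact sub_eq_zero.1 this

/-- A preconnected set on which every nonvanishing continuous function has a continuous
logarithm. -/
def HasLogs {X : Type*} [TopologicalSpace X] (S : Set X) : Prop :=
  IsPreconnected S ∧ ∀ f : X → ℂ, ContinuousOn f S → (∀ x ∈ S, f x ≠ 0) →
    ∃ L : X → ℂ, ContinuousOn L S ∧ ∀ x ∈ S, exp (L x) = f x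

lemma hasLogs_empty {X : Type*} [TopologicalSpace X] : HasLogs (∅ : Set X) :=
  ⟨isPreconnected_empty, fun _ _ _ => ⟨0, by simp, by simp⟩⟩

/-- A continuous logarithm can be normalised at a point. -/
lemma HasLogs.exists_log {X : Type*} [TopologicalSpace X] {S : Set X} (hS : HasLogs S)
    {f : X → ℂ} (hf : ContinuousOn f S) (hf0 : ∀ x ∈ S, f x ≠ 0) {a : X} (ha : a ∈ S) {c : ℂ}
    (hc : exp c = f a) :
    ∃ L : X → ℂ, ContinuousOn L S ∧ (∀ x ∈ S, exp (L x) = f x) ∧ L a = c := by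
  obtain ⟨L, hL, hLf⟩ := hS.2 f hf hf0
  refine ⟨fun x => L x + (c - L a), hL.add continuousOn_const, fun x hx => ?_, by ring⟩
  rw [exp_add, exp_sub, hLf x hx, hLf a ha, hc, div_self (hf0 a ha), mul_one]

lemma hasLogs_image_iff {X Y : Type*} [TopologicalSpace X] [TopologicalSpace Y] {g : X → Y}
    (hg : Topology.IsEmbedding g) {S : Set X} : HasLogs (g '' S) ↔ HasLogs S := by
  unfold HasLogs
  rw [hg.isInducing.isPreconnected_image]
  refine and_congr_right fun _ => ⟨fun h f hf hf0 => ?_, fun h f hf hf0 => ?_⟩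
  · rcases isEmpty_or_nonempty X with hX | hX
    · exact ⟨0, continuousOn_const, fun x => (IsEmpty.false x).elim⟩
    have hinv : Function.LeftInverse (Function.invFun g) g :=
      Function.leftInverse_invFun hg.injective
    obtain ⟨L, hL, hLf⟩ := h (f ∘ Function.invFun g)
      (by
        rw [hg.isInducing.continuousOn_image_iff, Function.comp_assoc, hinv.comp_eq_id]
        exact hf)
      (by
        rintro _ ⟨x, hx, rfl⟩
        simpa [hinv x] using hf0 x hx)
    refine ⟨L ∘ g, (hg.isInducing.continuousOn_image_iff).1 hL, fun x hx => ?_⟩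
    have := hLf (g x) ⟨x, hx, rfl⟩
    simpa [hinv x] using this
  · rcases isEmpty_or_nonempty X with hX | hX
    · refine ⟨0, continuousOn_const, ?_⟩
      rintro _ ⟨x, -, -⟩
      exact (IsEmpty.false x).elim
    have hinv : Function.LeftInverse (Function.invFun g) g :=
      Function.leftInverse_invFun hg.injective
    obtain ⟨L, hL, hLf⟩ := h (f ∘ g) ((hg.isInducing.continuousOn_image_iff).1 hf)
      (fun x hx => hf0 (g x) ⟨x, hx, rfl⟩)
    refine ⟨L ∘ Function.invFun g, ?_, ?_⟩
    · rw [hg.isInducing.continuousOn_image_iff, Function.comp_assoc, hinv.comp_eq_id]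
      exact hL
    · rintro _ ⟨x, hx, rfl⟩
      simpa [hinv x] using hLf x hx

/-- A nonvanishing continuous function has a continuous logarithm locally. -/
lemma exists_local_log {X : Type*} [TopologicalSpace X] {D : Set X} (hD : IsOpen D) {f : X → ℂ}
    (hf : ContinuousOn f D) {w : X} (hw : w ∈ D) (c : ℂ) (hc : exp c = f w) :
    ∃ l : X → ℂ, l w = c ∧ ∀ᶠ x in 𝓝 w, ContinuousAt l x ∧ exp (l x) = f x := by
  have hfw : f w ≠ 0 := hc ▸ exp_ne_zero c
  refine ⟨fun x => c + log (f x / f w), by simp [hfw], ?_⟩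
  have hcw : ContinuousAt f w := hf.continuousAt (hD.mem_nhds hw)
  have h1 : ∀ᶠ x in 𝓝 w, f x / f w ∈ slitPlane := by
    have : ContinuousAt (fun x => f x / f w) w := hcw.div_const _
    exact this.eventually_mem (isOpen_slitPlane.mem_nhds (by simp [hfw]))
  filter_upwards [h1, hD.mem_nhds hw] with x hx hxD
  refine ⟨continuousAt_const.add (((hf.continuousAt (hD.mem_nhds hxD)).div_const _).clog hx), ?_⟩
  rw [exp_add, exp_log (slitPlane_ne_zero hx), hc, mul_div_cancel₀ _ hfw]

/-- Propagation of continuity of a logarithm `L` along a family of sets on which `L` is known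
to be continuous. -/
lemma eventually_continuousAt_of_family {X : Type*} [TopologicalSpace X] {N : Set X}
    (hN : IsOpen N) {w : X} (hw : w ∈ N) {L l : X → ℂ} (hl : ContinuousOn l N)
    (he : ∀ x ∈ N, exp (l x) = exp (L x)) (c : ℂ) (σ : X → X)
    (h : ∀ᶠ x in 𝓝 w, ∃ T ⊆ N, IsPreconnected T ∧ x ∈ T ∧ σ x ∈ T ∧ ContinuousOn L T ∧
      L (σ x) = l (σ x) + c) :
    ∀ᶠ x in 𝓝 w, ContinuousAt L x := by
  have h1 : ∀ᶠ x in 𝓝 w, L x = l x + c := by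
    filter_upwards [h] with x ⟨T, hTN, hT, hxT, hσT, hLT, hc⟩
    have hexpc : exp c = 1 := by
      have := he _ (hTN hσT)
      rw [hc, exp_add] at this
      exact (mul_eq_left₀ (exp_ne_zero _)).1 this.symm
    refine eqOn_of_exp_eqOn hT hLT ((hl.mono hTN).add continuousOn_const) (fun y hy => ?_) hσT hc
      x hxT
    change exp (L y) = exp (l y + c)
    rw [exp_add, hexpc, mul_one, he y (hTN hy)]
  filter_upwards [h1.eventually_nhds, hN.mem_nhds hw] with x hx hxN
  have : ContinuousAt (fun y => l y + c) x :=
    (hl.continuousAt (hN.mem_nhds hxN)).add continuousAt_const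
  exact this.congr (hx.mono fun y hy => hy.symm)

/-- If continuity near one point of a preconnected set `F` propagates along `F`, it holds near
every point of `F`. -/
lemma eventually_continuousAt_of_propagation {X : Type*} [TopologicalSpace X] {F : Set X}
    (hF : IsPreconnected F) {L : X → ℂ} {p : X} (hp : p ∈ F)
    (h0 : ∀ᶠ x in 𝓝 p, ContinuousAt L x)
    (h1 : ∀ w ∈ F, ∃ N ∈ 𝓝 w, ∀ y ∈ N ∩ F, (∀ᶠ x in 𝓝 y, ContinuousAt L x) →
      ∀ᶠ x in 𝓝 w, ContinuousAt L x) :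
    ∀ w ∈ F, ContinuousAt L w := by
  have := isPreconnected_iff_preconnectedSpace.1 hF
  have hclopen : IsClopen {x : F | ∀ᶠ y in 𝓝 (x : X), ContinuousAt L y} := by
    constructor
    · rw [← closure_subset_iff_isClosed]
      intro w hw
      obtain ⟨N, hN, h⟩ := h1 w w.2
      obtain ⟨y, hyN, hy⟩ := mem_closure_iff_nhds.1 hw _ (continuousAt_subtype_val hN)
      exact h y ⟨hyN, y.2⟩ hy
    · have : IsOpen {x : X | ∀ᶠ y in 𝓝 x, ContinuousAt L y} := isOpen_setOfPred_eventually_nhds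
      exact this.preimage continuous_subtype_val
  have huniv := hclopen.eq_univ ⟨⟨p, hp⟩, h0⟩
  intro x hx
  have : (⟨x, hx⟩ : F) ∈ {x : F | ∀ᶠ y in 𝓝 (x : X), ContinuousAt L y} := by
    rw [huniv]; trivial
  exact Filter.Eventually.self_of_nhds this

section

variable {E : Type*} [NormedAddCommGroup E] [NormedSpace ℂ E]

/-- The complex affine line through `p` with direction `X`. -/
def affineLine (p X : E) : Set E := range fun l : ℂ => p + l • X

lemma convex_affineLine (p X : E) : Convex ℝ (affineLine p X) := by
  rintro _ ⟨l, rfl⟩ _ ⟨m, rfl⟩ a b - - hab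
  refine ⟨a * l + b * m, ?_⟩
  have hab' : (a : ℂ) + b = 1 := by exact_mod_cast hab
  have h1 : ∀ v : E, a • v = (a : ℂ) • v := fun v => (Complex.coe_smul a v).symm
  have h2 : ∀ v : E, b • v = (b : ℂ) • v := fun v => (Complex.coe_smul b v).symm
  simp only [h1, h2]
  calc p + ((a : ℂ) * l + b * m) • X = ((a : ℂ) + b) • p + ((a : ℂ) * l + b * m) • X := by
        rw [hab', one_smul]
    _ = _ := by module

/-- Every slice of `D` by a complex line is preconnected and carries continuous logarithms. -/
def LineAcyclic (D : Set E) : Prop := ∀ z X : E, X ≠ 0 → HasLogs (D ∩ affineLine z X)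

lemma mem_affineLine_self (p X : E) : p ∈ affineLine p X := ⟨0, by simp⟩

lemma mem_affineLine_sub (p w : E) : w ∈ affineLine p (w - p) := ⟨1, by simp⟩

lemma affineLine_smul (p X : E) {l : ℂ} (hl : l ≠ 0) : affineLine p (l • X) = affineLine p X := by
  ext w
  constructor
  · rintro ⟨m, rfl⟩
    exact ⟨m * l, by simp [mul_smul]⟩
  · rintro ⟨m, rfl⟩
    exact ⟨m / l, by simp only [smul_smul]; rw [div_mul_cancel₀ _ hl]⟩

/-- A preconnected set on which two points always lie on a common slice is preconnected. -/
lemma LineAcyclic.isPreconnected {D : Set E} (hD : LineAcyclic D) : IsPreconnected D := by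
  refine isPreconnected_of_forall_pair fun x hx y hy => ?_
  by_cases hxy : y - x = 0
  · exact ⟨{x}, by simpa using hx, rfl, by simp [sub_eq_zero.1 hxy], isPreconnected_singleton⟩
  · exact ⟨D ∩ affineLine x (y - x), inter_subset_left, ⟨hx, mem_affineLine_self _ _⟩,
      ⟨hy, mem_affineLine_sub _ _⟩, (hD x _ hxy).1⟩

/-- An open set all of whose slices by complex lines are connected and carry logarithms
carries logarithms itself. -/
lemma LineAcyclic.hasLogs {D : Set E} (hD : IsOpen D) (hL : LineAcyclic D) : HasLogs D := by
  refine ⟨hL.isPreconnected, fun f hf hf0 => ?_⟩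
  rcases D.eq_empty_or_nonempty with rfl | ⟨p, hp⟩
  · exact ⟨0, by simp, by simp⟩
  set c := log (f p) with hc
  have hexpc : exp c = f p := exp_log (hf0 p hp)
  have hB : ∀ X : E, ∃ B : E → ℂ, B p = c ∧ (X ≠ 0 → ContinuousOn B (D ∩ affineLine p X) ∧
      ∀ x ∈ D ∩ affineLine p X, exp (B x) = f x) := by
    intro X
    by_cases hX : X = 0
    · exact ⟨fun _ => c, rfl, fun h => (h hX).elim⟩
    · obtain ⟨B, h1, h2, h3⟩ := (hL p X hX).exists_log (hf.mono inter_subset_left)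
        (fun x hx => hf0 x hx.1) ⟨hp, mem_affineLine_self p X⟩ hexpc
      exact ⟨B, h3, fun _ => ⟨h1, h2⟩⟩
  choose B hBp hB using hB
  set L : E → ℂ := fun w => B (w - p) w with hLdef
  have hLp : L p = c := hBp _
  have hLB : ∀ X, X ≠ 0 → ∀ w ∈ D ∩ affineLine p X, L w = B X w := by
    intro X hX w ⟨hwD, hw⟩
    obtain ⟨l, rfl⟩ := hw
    by_cases hl : l = 0
    · simp [hl, hLp, hBp]
    have hlX : l • X ≠ 0 := smul_ne_zero hl hX
    have heq : p + l • X - p = l • X := by abel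
    have h1 := hB (l • X) hlX
    rw [affineLine_smul p X hl] at h1
    simp only [hLdef, heq]
    exact eqOn_of_exp_eqOn (hL p X hX).1 h1.1 (hB X hX).1
      (fun x hx => (h1.2 x hx).trans ((hB X hX).2 x hx).symm) ⟨hp, mem_affineLine_self p X⟩
      ((hBp _).trans (hBp _).symm) _ ⟨hwD, l, rfl⟩
  have hLcont : ∀ X, X ≠ 0 → ContinuousOn L (D ∩ affineLine p X) := fun X hX =>
    (hB X hX).1.congr (hLB X hX)
  have hLexp : ∀ w ∈ D, exp (L w) = f w := by
    intro w hw
    by_cases hwp : w - p = 0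
    · rw [sub_eq_zero.1 hwp, hLp, hexpc]
    · exact (hB _ hwp).2 w ⟨hw, mem_affineLine_sub p w⟩
  -- the local situation
  have hloc : ∀ w ∈ D, ∃ r > 0, ∃ l : E → ℂ, ball w r ⊆ D ∧ l w = L w ∧
      ContinuousOn l (ball w r) ∧ ∀ x ∈ ball w r, exp (l x) = exp (L x) := by
    intro w hw
    obtain ⟨l, hlw, hl⟩ := exists_local_log hD hf hw (L w) (hLexp w hw)
    obtain ⟨r, hr, hball⟩ := Metric.mem_nhds_iff.1 (Filter.inter_mem hl (hD.mem_nhds hw))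
    refine ⟨r, hr, l, fun x hx => (hball hx).2, hlw,
      fun x hx => (hball hx).1.1.continuousWithinAt, fun x hx => ?_⟩
    rw [(hball hx).1.2, hLexp x (hball hx).2]
  have hp0 : ∀ᶠ x in 𝓝 p, ContinuousAt L x := by
    obtain ⟨r, hr, l, hrD, hlp, hlc, hle⟩ := hloc p hp
    refine eventually_continuousAt_of_family isOpen_ball (mem_ball_self hr) hlc hle 0 (fun _ => p) ?_
    filter_upwards [ball_mem_nhds p hr] with x hx
    by_cases hxp : x - p = 0
    · refine ⟨{p}, singleton_subset_iff.2 (mem_ball_self hr), isPreconnected_singleton,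
        by simp [sub_eq_zero.1 hxp], rfl, continuousOn_singleton _ _, by simp [hlp]⟩
    refine ⟨ball p r ∩ affineLine p (x - p), inter_subset_left,
      ((convex_ball p r).inter (convex_affineLine _ _)).isPreconnected,
      ⟨hx, mem_affineLine_sub _ _⟩, ⟨mem_ball_self hr, mem_affineLine_self _ _⟩,
      (hLcont _ hxp).mono (inter_subset_inter_left _ hrD), by simp [hlp]⟩
  refine ⟨L, ?_, hLexp⟩
  intro w hw
  refine ContinuousAt.continuousWithinAt ?_
  by_cases hwp : w - p = 0
  · rw [sub_eq_zero.1 hwp]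
    exact hp0.self_of_nhds
  refine eventually_continuousAt_of_propagation (F := D ∩ affineLine p (w - p)) (hL p _ hwp).1
    ⟨hp, mem_affineLine_self _ _⟩ hp0 (fun w₁ hw₁ => ?_) w ⟨hw, mem_affineLine_sub _ _⟩
  by_cases hw₁p : w₁ - p = 0
  · exact ⟨univ, Filter.univ_mem, fun y _ _ => by rwa [sub_eq_zero.1 hw₁p]⟩
  obtain ⟨r, hr, l, hrD, hlp, hlc, hle⟩ := hloc w₁ hw₁.1
  refine ⟨ball w₁ r, ball_mem_nhds _ hr, fun y hy hyL => ?_⟩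
  -- `y` is a multiple of `w₁` as seen from `p`
  obtain ⟨m, hm⟩ : ∃ m : ℂ, y = p + m • (w₁ - p) := by
    obtain ⟨a, ha⟩ := hw₁.2
    obtain ⟨b, hb⟩ := hy.2.2
    have ha0 : a ≠ 0 := by
      rintro rfl
      exact hw₁p (by rw [← ha]; simp)
    refine ⟨b / a, ?_⟩
    rw [← ha, ← hb]
    simp only [add_sub_cancel_left, smul_smul]
    rw [div_mul_cancel₀ _ ha0]
  set σ : E → E := fun x => p + m • (x - p) with hσ
  have hσw : σ w₁ = y := hm.symm
  have hσc : ContinuousAt σ w₁ := by fun_prop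
  refine eventually_continuousAt_of_family isOpen_ball (mem_ball_self hr) hlc hle (L y - l y) σ ?_
  have hconst : ∀ᶠ x in 𝓝 y, L x - l x = L y - l y := by
    have hcont : ContinuousAt (fun x => L x - l x) y :=
      hyL.self_of_nhds.sub (hlc.continuousAt (isOpen_ball.mem_nhds hy.1))
    filter_upwards [hcont.eventually (ball_mem_nhds _ one_pos), isOpen_ball.mem_nhds hy.1]
      with x hx hxr
    refine eq_of_exp_eq_of_norm_sub_lt ?_ (by rwa [dist_eq_norm] at hx)
    rw [exp_sub, exp_sub, hle x hxr, hle y hy.1, div_self (exp_ne_zero _),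
      div_self (exp_ne_zero _)]
  rw [← hσw] at hconst
  have h1 := hσc.eventually hconst
  have h2 : ∀ᶠ x in 𝓝 w₁, σ x ∈ ball w₁ r :=
    hσc.eventually_mem (isOpen_ball.mem_nhds (hσw ▸ hy.1))
  have h3 : ∀ᶠ x in 𝓝 w₁, x - p ≠ 0 :=
    (by fun_prop : ContinuousAt (fun x => x - p) w₁).eventually_ne hw₁p
  filter_upwards [h1, h2, h3, ball_mem_nhds w₁ hr] with x hx1 hx2 hx3 hx4
  refine ⟨ball w₁ r ∩ affineLine p (x - p), inter_subset_left,
      ((convex_ball _ r).inter (convex_affineLine _ _)).isPreconnected,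
      ⟨hx4, mem_affineLine_sub _ _⟩, ⟨hx2, m, rfl⟩,
      (hLcont _ hx3).mono (inter_subset_inter_left _ hrD), ?_⟩
  rw [hσw] at hx1
  rw [← hx1]
  ring

lemma LineAcyclic.preimage_subtype {D : Set E} (hD : LineAcyclic D) (K : Submodule ℂ E) :
    LineAcyclic ((↑) ⁻¹' D : Set K) := by
  intro z X hX
  rw [← hasLogs_image_iff (g := ((↑) : K → E)) Topology.IsEmbedding.subtypeVal]
  have : ((↑) : K → E) '' ((↑) ⁻¹' D ∩ affineLine z X) = D ∩ affineLine (z : E) (X : E) := by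
    ext w
    constructor
    · rintro ⟨k, ⟨hk, l, rfl⟩, rfl⟩
      exact ⟨hk, l, by simp⟩
    · rintro ⟨hw, l, rfl⟩
      exact ⟨z + l • X, ⟨by simpa using hw, l, rfl⟩, by simp⟩
  rw [this]
  exact hD z X (by simpa using hX)

lemma LineAcyclic.hasLogs_inter {D : Set E} (hDo : IsOpen D) (hD : LineAcyclic D)
    (K : Submodule ℂ E) : HasLogs (D ∩ K) := by
  have h := (hD.preimage_subtype K).hasLogs (hDo.preimage continuous_subtype_val)
  rw [← hasLogs_image_iff (g := ((↑) : K → E)) Topology.IsEmbedding.subtypeVal] at h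
  have heq : ((↑) : K → E) '' ((↑) ⁻¹' D) = D ∩ K := by
    ext w
    constructor
    · rintro ⟨k, hk, rfl⟩
      exact ⟨hk, k.2⟩
    · rintro ⟨hw, hwK⟩
      exact ⟨⟨w, hwK⟩, hw, rfl⟩
  rwa [heq] at h

lemma LineAcyclic.preimage_add {D : Set E} (hD : LineAcyclic D) (a : E) :
    LineAcyclic ((fun w => w + a) ⁻¹' D) := by
  intro z X hX
  rw [← hasLogs_image_iff (g := fun w : E => w + a) (Homeomorph.addRight a).isEmbedding]
  have : (fun w : E => w + a) '' ((fun w => w + a) ⁻¹' D ∩ affineLine z X) =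
      D ∩ affineLine (z + a) X := by
    ext w
    constructor
    · rintro ⟨k, ⟨hk, l, rfl⟩, rfl⟩
      exact ⟨hk, l, by simp only []; abel⟩
    · rintro ⟨hw, l, rfl⟩
      refine ⟨z + l • X, ⟨?_, l, rfl⟩, by simp only []; abel⟩
      have : z + l • X + a = z + a + l • X := by abel
      simpa [this] using hw
  rw [this]
  exact hD _ X hX

/-- Local logarithms of `x`, defined on all fibres of `y / x` close to a given one. -/
lemma LineAcyclic.exists_log_near_fibre {D : Set E} (hDo : IsOpen D) (hD : LineAcyclic D)
    (x y : E →L[ℂ] ℂ) (e : E) (hxe : x e = 0) (hye : y e = 1)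
    (h0 : ∀ w ∈ D, x w = 0 → y w ≠ 0) {w₀ : E} (hw₀ : w₀ ∈ D) (hx₀ : x w₀ ≠ 0) :
    ∃ r > 0, ∃ L : E → ℂ, ∀ w ∈ D, x w ≠ 0 → y w / x w ∈ ball (y w₀ / x w₀) r →
      ContinuousAt L w ∧ exp (L w) = x w := by
  set s : ℂ → E := fun t => w₀ + ((t - y w₀ / x w₀) * x w₀) • e with hs
  have hsc : Continuous s := by fun_prop
  have hs0 : s (y w₀ / x w₀) = w₀ := by simp [hs]
  have hxs : ∀ t, x (s t) = x w₀ := fun t => by simp [hs, hxe]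
  have hys : ∀ t, y (s t) = t * x w₀ := fun t => by
    simp only [hs, map_add, map_smul, hye, smul_eq_mul, mul_one]
    field_simp
    ring
  obtain ⟨r, hr, hrD⟩ : ∃ r > 0, ball (y w₀ / x w₀) r ⊆ s ⁻¹' D :=
    Metric.mem_nhds_iff.1 (hsc.continuousAt.preimage_mem_nhds (by rw [hs0]; exact hDo.mem_nhds hw₀))
  set K : ℂ → Submodule ℂ E := fun t => LinearMap.ker (y - t • x : E →L[ℂ] ℂ).toLinearMap with hK
  have hmemK : ∀ t w, w ∈ K t ↔ y w = t * x w := fun t w => by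
    simp [hK, sub_eq_zero]
  have hKx : ∀ t, ∀ w ∈ D ∩ K t, x w ≠ 0 := by
    rintro t w ⟨hwD, hw⟩ hxw
    have := (hmemK t w).1 hw
    rw [hxw, mul_zero] at this
    exact h0 w hwD hxw this
  have hKt : ∀ t, ∀ w ∈ D ∩ K t, y w / x w = t := fun t w hw => by
    rw [div_eq_iff (hKx t w hw)]
    exact (hmemK t w).1 hw.2
  have hsK : ∀ t, s t ∈ K t := fun t => by rw [hmemK, hys, hxs]
  have hKconv : ∀ t, Convex ℝ (K t : Set E) := fun t => ((K t).restrictScalars ℝ).convex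
  set c := log (x w₀) with hc
  have hexpc : exp c = x w₀ := exp_log hx₀
  have hB : ∀ t, ∃ B : E → ℂ, t ∈ ball (y w₀ / x w₀) r → ContinuousOn B (D ∩ K t) ∧
      (∀ w ∈ D ∩ K t, exp (B w) = x w) ∧ B (s t) = c := by
    intro t
    by_cases ht : t ∈ ball (y w₀ / x w₀) r
    · obtain ⟨B, hB⟩ := (hD.hasLogs_inter hDo (K t)).exists_log x.continuous.continuousOn (hKx t)
        (a := s t) ⟨hrD ht, hsK t⟩ (c := c) (by rw [hexpc, hxs])
      exact ⟨B, fun _ => hB⟩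
    · exact ⟨0, fun h => (ht h).elim⟩
  choose B hB using hB
  set τ : E → ℂ := fun w => y w / x w with hτ
  set L : E → ℂ := fun w => B (τ w) w with hL
  have hmem : ∀ w ∈ D, x w ≠ 0 → w ∈ D ∩ K (τ w) := fun w hw hxw =>
    ⟨hw, by change w ∈ K (τ w); rw [hmemK]; simp only [hτ]; field_simp⟩
  have hLB : ∀ t, ∀ w ∈ D ∩ K t, L w = B t w := fun t w hw => by
    simp only [hL, hτ]
    rw [hKt t w hw]
  have hLcont : ∀ t ∈ ball (y w₀ / x w₀) r, ContinuousOn L (D ∩ K t) := fun t ht =>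
    (hB t ht).1.congr (hLB t)
  have hLexp : ∀ w ∈ D, x w ≠ 0 → τ w ∈ ball (y w₀ / x w₀) r → exp (L w) = x w :=
    fun w hw hxw ht => (hB _ ht).2.1 w (hmem w hw hxw)
  have hLs : ∀ t ∈ ball (y w₀ / x w₀) r, L (s t) = c := fun t ht => by
    rw [hLB t _ ⟨hrD ht, hsK t⟩, (hB t ht).2.2]
  refine ⟨r, hr, L, fun w hw hxw ht => ⟨?_, hLexp w hw hxw ht⟩⟩
  have hτc : ∀ w, x w ≠ 0 → ContinuousAt τ w := fun w hxw =>
    y.continuous.continuousAt.div x.continuous.continuousAt hxw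
  -- the local situation
  have hloc : ∀ w ∈ D, x w ≠ 0 → τ w ∈ ball (y w₀ / x w₀) r → ∃ ρ > 0, ∃ l : E → ℂ,
      ball w ρ ⊆ D ∧ (∀ v ∈ ball w ρ, x v ≠ 0 ∧ τ v ∈ ball (y w₀ / x w₀) r) ∧ l w = L w ∧
      ContinuousOn l (ball w ρ) ∧ ∀ v ∈ ball w ρ, exp (l v) = exp (L v) := by
    intro w hw hxw hτw
    obtain ⟨l, hlw, hl⟩ := exists_local_log hDo x.continuous.continuousOn hw (L w)
      (hLexp w hw hxw hτw)
    have h2 : ∀ᶠ v in 𝓝 w, x v ≠ 0 ∧ τ v ∈ ball (y w₀ / x w₀) r :=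
      (x.continuous.continuousAt.eventually_ne hxw).and
        ((hτc w hxw).eventually_mem (isOpen_ball.mem_nhds hτw))
    obtain ⟨ρ, hρ, hball⟩ := Metric.mem_nhds_iff.1
      (Filter.inter_mem (Filter.inter_mem hl h2) (hDo.mem_nhds hw))
    refine ⟨ρ, hρ, l, fun v hv => (hball hv).2, fun v hv => (hball hv).1.2, hlw,
      fun v hv => (hball hv).1.1.1.continuousWithinAt, fun v hv => ?_⟩
    rw [(hball hv).1.1.2, hLexp v (hball hv).2 (hball hv).1.2.1 (hball hv).1.2.2]
  have hfam : ∀ (w : E) (ρ : ℝ), ball w ρ ⊆ D →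
      (∀ v ∈ ball w ρ, x v ≠ 0 ∧ τ v ∈ ball (y w₀ / x w₀) r) → ∀ (l : E → ℂ) (c' : ℂ) (v v' : E),
      v ∈ ball w ρ → v' ∈ ball w ρ → v' ∈ K (τ v) → L v' = l v' + c' →
      ∃ T ⊆ ball w ρ, IsPreconnected T ∧ v ∈ T ∧ v' ∈ T ∧ ContinuousOn L T ∧
        L v' = l v' + c' := by
    intro w ρ hρD hρ l c' v v' hv hv' hv'K hLl
    exact ⟨ball w ρ ∩ K (τ v), inter_subset_left,
      ((convex_ball w ρ).inter (hKconv _)).isPreconnected, ⟨hv, (hmem v (hρD hv) (hρ v hv).1).2⟩,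
      ⟨hv', hv'K⟩, (hLcont _ (hρ v hv).2).mono (inter_subset_inter_left _ hρD), hLl⟩
  have hclose : ∀ (l : E → ℂ) (w v : E) (ρ : ℝ), v ∈ ball w ρ → ContinuousOn l (ball w ρ) →
      (∀ u ∈ ball w ρ, exp (l u) = exp (L u)) → ContinuousAt L v →
      ∀ᶠ u in 𝓝 v, L u = l u + (L v - l v) := by
    intro l w v ρ hv hlc hle hLv
    have hcont : ContinuousAt (fun x => L x - l x) v :=
      hLv.sub (hlc.continuousAt (isOpen_ball.mem_nhds hv))
    filter_upwards [hcont.eventually (ball_mem_nhds _ one_pos), isOpen_ball.mem_nhds hv]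
      with u hu hur
    have := eq_of_exp_eq_of_norm_sub_lt (a := L u - l u) (b := L v - l v)
      (by rw [exp_sub, exp_sub, hle u hur, hle v hv, div_self (exp_ne_zero _),
        div_self (exp_ne_zero _)]) (by rwa [dist_eq_norm] at hu)
    rw [← this]; ring
  set t := τ w with htdef
  have hp0 : ∀ᶠ v in 𝓝 (s t), ContinuousAt L v := by
    have hst : τ (s t) = t := hKt t _ ⟨hrD ht, hsK t⟩
    have hxst : x (s t) ≠ 0 := by rwa [hxs]
    obtain ⟨ρ, hρ, l, hρD, hρx, hlp, hlc, hle⟩ := hloc (s t) (hrD ht) hxst (by rwa [hst])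
    have hσc : ContinuousAt (fun v => s (τ v)) (s t) :=
      hsc.continuousAt.comp (hτc _ hxst)
    refine eventually_continuousAt_of_family isOpen_ball (mem_ball_self hρ) hlc hle 0
      (fun v => s (τ v)) ?_
    have h1 : ∀ᶠ v in 𝓝 (s t), s (τ v) ∈ ball (s t) ρ :=
      hσc.eventually_mem (by simp only [hst]; exact ball_mem_nhds _ hρ)
    have h2 : ∀ᶠ v in 𝓝 (s t), ‖l (s (τ v)) - c‖ < 1 := by
      have hlσ : ContinuousAt (fun v => l (s (τ v))) (s t) := by
        refine ContinuousAt.comp (f := fun v => s (τ v)) ?_ hσc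
        simp only [hst]
        exact hlc.continuousAt (ball_mem_nhds _ hρ)
      have : ContinuousAt (fun v => ‖l (s (τ v)) - c‖) (s t) := (hlσ.sub continuousAt_const).norm
      refine this.eventually_lt continuousAt_const ?_
      simp [hst, hlp, hLs t ht]
    filter_upwards [h1, h2, ball_mem_nhds (s t) hρ] with v hv1 hv2 hv3
    have hLc := hLs (τ v) (hρx v hv3).2
    have hlc' : l (s (τ v)) = c :=
      eq_of_exp_eq_of_norm_sub_lt (by rw [hle _ hv1, hLc]) hv2
    exact hfam _ _ hρD hρx l 0 v _ hv3 hv1 (hsK _) (by rw [hLc, hlc', add_zero])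
  refine eventually_continuousAt_of_propagation (F := D ∩ K t) (hD.hasLogs_inter hDo _).1
    ⟨hrD ht, hsK t⟩ hp0 (fun w₁ hw₁ => ?_) w (hmem w hw hxw)
  have hτ₁ : τ w₁ = t := hKt t w₁ hw₁
  have hx₁ := hKx t w₁ hw₁
  obtain ⟨ρ, hρ, l, hρD, hρx, hlp, hlc, hle⟩ := hloc w₁ hw₁.1 hx₁ (by rwa [hτ₁])
  refine ⟨ball w₁ ρ, ball_mem_nhds _ hρ, fun v hv hvL => ?_⟩
  have hτv : τ v = t := hKt t v hv.2
  have hxv := hKx t v hv.2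
  set σ : E → E := fun u => v + ((τ u - t) * x v) • e with hσ
  have hσw : σ w₁ = v := by simp [hσ, hτ₁]
  have hσc : ContinuousAt σ w₁ := by
    have := hτc w₁ hx₁
    fun_prop
  have hσK : ∀ u, σ u ∈ K (τ u) := fun u => by
    have := (hmemK t v).1 hv.2.2
    rw [hmemK]
    simp only [hσ, map_add, map_smul, hxe, hye, smul_eq_mul, this]
    ring
  refine eventually_continuousAt_of_family isOpen_ball (mem_ball_self hρ) hlc hle (L v - l v) σ ?_
  have h1 := hclose l w₁ v ρ hv.1 hlc hle hvL.self_of_nhds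
  have h2 := hσc.eventually (p := fun u => L u = l u + (L v - l v)) (by rwa [hσw])
  have h3 : ∀ᶠ u in 𝓝 w₁, σ u ∈ ball w₁ ρ :=
    hσc.eventually_mem (isOpen_ball.mem_nhds (hσw ▸ hv.1))
  filter_upwards [h2, h3, ball_mem_nhds w₁ hρ] with u hu2 hu3 hu4
  exact hfam _ _ hρD hρx l _ u _ hu4 hu3 (hσK u) hu2

/-- On `D ∖ {x = 0}` the function `x` is the product of an exponential and a function
of `y / x` which is defined on all of `ℂ`, provided that all fibres of `y / x` are nonempty. -/
lemma LineAcyclic.exists_chart {D : Set E} (hDo : IsOpen D) (hD : LineAcyclic D)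
    (x y : E →L[ℂ] ℂ) (e : E) (hxe : x e = 0) (hye : y e = 1)
    (h0 : ∀ w ∈ D, x w = 0 → y w ≠ 0) (hs : ∀ t : ℂ, ∃ w ∈ D, x w ≠ 0 ∧ y w / x w = t) :
    ∃ (M : E → ℂ) (u : ℂ → ℂ), (∀ w ∈ D, x w ≠ 0 → ContinuousAt M w) ∧ Continuous u ∧
      (∀ t, u t ≠ 0) ∧ ∀ w ∈ D, x w ≠ 0 → x w = u (y w / x w) * exp (M w) := by
  choose w₀ hw₀ hx₀ ht₀ using hs
  choose r hr L hL using fun t => hD.exists_log_near_fibre hDo x y e hxe hye h0 (hw₀ t) (hx₀ t)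
  obtain ⟨ρ, hρ⟩ := PartitionOfUnity.exists_isSubordinate (s := (univ : Set ℂ)) isClosed_univ
    (fun t => ball t (r t)) (fun t => isOpen_ball)
    (fun t _ => mem_iUnion.2 ⟨t, mem_ball_self (hr t)⟩)
  set τ : E → ℂ := fun w => y w / x w with hτ
  have hτc : ∀ w, x w ≠ 0 → ContinuousAt τ w := fun w hxw =>
    y.continuous.continuousAt.div x.continuous.continuousAt hxw
  have hL' : ∀ i, ∀ w ∈ D, x w ≠ 0 → τ w ∈ ball i (r i) →
      ContinuousAt (L i) w ∧ exp (L i w) = x w := fun i w hw hxw ht =>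
    hL i w hw hxw (by rw [ht₀]; exact ht)
  set M : E → ℂ := fun w => ∑ᶠ i, (ρ i (τ w) : ℂ) * L i w with hM
  have hρmem : ∀ i t, ρ i t ≠ 0 → t ∈ ball i (r i) := fun i t h =>
    hρ i (subset_tsupport _ h)
  have hMc : ∀ w ∈ D, x w ≠ 0 → ContinuousAt M w := by
    intro w hw hxw
    obtain ⟨I, hI⟩ := ρ.exists_finset_nhds (τ w)
    have h1 : ∀ᶠ v in 𝓝 w, M v = ∑ i ∈ I, (ρ i (τ v) : ℂ) * L i v := by
      filter_upwards [(hτc w hxw).eventually hI] with v hv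
      refine finsum_eq_sum_of_support_subset _ fun i hi => ?_
      have : ρ i (τ v) ≠ 0 := by
        intro h
        exact hi (by simp [h])
      exact hv.2 this
    refine ContinuousAt.congr ?_ (h1.mono fun v hv => hv.symm)
    refine tendsto_finsetSum _ fun i _ => ?_
    change ContinuousAt (fun v => (ρ i (τ v) : ℂ) * L i v) w
    have hρc : ContinuousAt (fun v => (ρ i (τ v) : ℂ)) w :=
      Complex.continuous_ofReal.continuousAt.comp
        (((ρ i).continuous.continuousAt).comp (hτc w hxw))
    by_cases hi : τ w ∈ ball i (r i)
    · exact hρc.mul (hL' i w hw hxw hi).1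
    · have h2 : ∀ᶠ v in 𝓝 w, ρ i (τ v) = 0 := by
        have : τ w ∈ (tsupport (ρ i))ᶜ := fun h => hi (hρ i h)
        filter_upwards [(hτc w hxw).eventually_mem ((isClosed_tsupport _).isOpen_compl.mem_nhds this)]
          with v hv
        exact image_eq_zero_of_notMem_tsupport hv
      exact (continuousAt_const (y := (0 : ℂ))).congr (h2.mono fun v hv => by simp [hv])
  -- the difference of values of `M` on a fibre
  have hfib : ∀ w ∈ D, ∀ w' ∈ D, x w ≠ 0 → x w' ≠ 0 → τ w = τ w' →
      x w / exp (M w) = x w' / exp (M w') := by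
    intro w hw w' hw' hxw hxw' hww'
    set t := τ w with ht
    have hpre := (hD.hasLogs_inter hDo (LinearMap.ker (y - t • x : E →L[ℂ] ℂ).toLinearMap)).1
    have hmem : ∀ v ∈ D, x v ≠ 0 → τ v = t →
        v ∈ D ∩ (LinearMap.ker (y - t • x : E →L[ℂ] ℂ).toLinearMap : Submodule ℂ E) := by
      intro v hv hxv hvt
      refine ⟨hv, ?_⟩
      have : y v = t * x v := by rw [← hvt]; simp only [hτ]; field_simp
      simp [this]
    have hmem' : ∀ v ∈ D ∩ (LinearMap.ker (y - t • x : E →L[ℂ] ℂ).toLinearMap : Submodule ℂ E),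
        v ∈ D ∧ x v ≠ 0 ∧ τ v = t := by
      rintro v ⟨hv, hvK⟩
      have hyv : y v = t * x v := by simpa [sub_eq_zero] using hvK
      have hxv : x v ≠ 0 := fun h => h0 v hv h (by rw [hyv, h, mul_zero])
      exact ⟨hv, hxv, by simp only [hτ]; rw [hyv, mul_div_cancel_right₀ _ hxv]⟩
    have hconst : ∀ i j, ρ i t ≠ 0 → ρ j t ≠ 0 → L i w' - L i w = L j w' - L j w := by
      intro i j hi hj
      have h1 := fun v hv => hL' i v (hmem' v hv).1 (hmem' v hv).2.1
        (by rw [(hmem' v hv).2.2]; exact hρmem i t hi)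
      have h2 := fun v hv => hL' j v (hmem' v hv).1 (hmem' v hv).2.1
        (by rw [(hmem' v hv).2.2]; exact hρmem j t hj)
      have hexp : exp (L i w - L j w) = 1 := by
        rw [exp_sub, (h1 w (hmem w hw hxw rfl)).2, (h2 w (hmem w hw hxw rfl)).2, div_self hxw]
      have := eqOn_of_exp_eqOn hpre (g₁ := L i) (g₂ := fun v => L j v + (L i w - L j w))
        (fun v hv => (h1 v hv).1.continuousWithinAt)
        (fun v hv => ((h2 v hv).1.add continuousAt_const).continuousWithinAt)
        (fun v hv => by rw [exp_add, hexp, mul_one, (h1 v hv).2, (h2 v hv).2])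
        (hmem w hw hxw rfl) (by ring) w' (hmem w' hw' hxw' hww'.symm)
      rw [this]; ring
    obtain ⟨j, hj⟩ := ρ.exists_pos (x := t) (mem_univ _)
    have hMdiff : M w' = M w + (L j w' - L j w) := by
      have hfs : ∀ g : ℂ → ℂ, (Function.support fun i => (ρ i t : ℂ) * g i).Finite := fun g =>
        (ρ.locallyFinite.point_finite t).subset fun i hi => by
          intro h
          exact hi (by simp [h])
      have hsum : ∑ᶠ i, (ρ i t : ℂ) * (L j w' - L j w) = L j w' - L j w := by
        rw [← finsum_mul]
        · have : ∑ᶠ i, (ρ i t : ℂ) = 1 := by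
            have h1 := ρ.sum_eq_one (mem_univ t)
            have h2 := (Complex.ofRealHom : ℝ →+* ℂ).toAddMonoidHom.map_finsum
              (f := fun i => ρ i t) (ρ.locallyFinite.point_finite t)
            rw [h1] at h2
            simpa using h2.symm
          rw [this, one_mul]
      rw [← hsum]
      simp only [hM]
      rw [← hww', ← ht, ← finsum_add_distrib (hfs fun i => L i w) (hfs fun _ => L j w' - L j w)]
      refine finsum_congr fun i => ?_
      by_cases hi : ρ i t = 0
      · simp [hi]
      · rw [← hconst i j hi hj.ne']; ring
    have h3 := hL' j w hw hxw (hρmem j t hj.ne')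
    have h4 := hL' j w' hw' hxw' (hww' ▸ hρmem j t hj.ne')
    rw [hMdiff, exp_add, exp_sub, h3.2, h4.2]
    field_simp [exp_ne_zero]
  set u : ℂ → ℂ := fun t => x (w₀ t) / exp (M (w₀ t)) with hu
  refine ⟨M, u, hMc, ?_, fun t => div_ne_zero (hx₀ t) (exp_ne_zero _), fun w hw hxw => ?_⟩
  · rw [continuous_iff_continuousAt]
    intro t₀
    set s : ℂ → E := fun t => w₀ t₀ + ((t - t₀) * x (w₀ t₀)) • e with hs
    have hsc : Continuous s := by fun_prop
    have hs0 : s t₀ = w₀ t₀ := by simp [hs]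
    have hxs : ∀ t, x (s t) = x (w₀ t₀) := fun t => by simp [hs, hxe]
    have hτs : ∀ t, τ (s t) = t := fun t => by
      have h1 := hx₀ t₀
      have h2 : y (w₀ t₀) = t₀ * x (w₀ t₀) := by
        rw [← ht₀ t₀, ht₀ t₀]
        have := ht₀ t₀
        rwa [div_eq_iff h1] at this
      simp only [hτ, hxs]
      simp only [hs, map_add, map_smul, hye, smul_eq_mul, mul_one, h2]
      field_simp
      ring
    have hev : ∀ᶠ t in 𝓝 t₀, u t = x (s t) / exp (M (s t)) := by
      have : ∀ᶠ t in 𝓝 t₀, s t ∈ D :=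
        hsc.continuousAt.eventually_mem (by rw [hs0]; exact hDo.mem_nhds (hw₀ t₀))
      filter_upwards [this] with t ht
      exact hfib _ (hw₀ t) _ ht (hx₀ t) (by rw [hxs]; exact hx₀ t₀) (by rw [hτs]; exact ht₀ t)
    refine ContinuousAt.congr ?_ (hev.mono fun t ht => ht.symm)
    have hMs : ContinuousAt (fun t => M (s t)) t₀ :=
      ContinuousAt.comp (g := M) (f := s) (by rw [hs0]; exact hMc _ (hw₀ t₀) (hx₀ t₀)) hsc.continuousAt
    exact (x.continuous.comp hsc).continuousAt.div hMs.cexp (exp_ne_zero _)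
  · have := hfib w hw _ (hw₀ (τ w)) hxw (hx₀ _) (ht₀ _).symm
    simp only [hu]
    change x w = x (w₀ (τ w)) / exp (M (w₀ (τ w))) * exp (M w)
    rw [← this, div_mul_cancel₀ _ (exp_ne_zero _)]

/-- There is no continuous logarithm on the punctured plane. -/
lemma not_exists_log_compl_zero {L : ℂ → ℂ} (hL : ContinuousOn L {0}ᶜ)
    (h : ∀ t ≠ 0, exp (L t) = t) : False := by
  have hc : Continuous fun θ : ℝ => L (exp (θ * I)) :=
    hL.comp_continuous (by fun_prop) fun θ => exp_ne_zero _
  have h1 := eqOn_of_exp_eqOn (S := (univ : Set ℝ)) isPreconnected_univ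
    (g₁ := fun θ : ℝ => L (exp (θ * I))) (g₂ := fun θ : ℝ => θ * I + L 1)
    hc.continuousOn (by fun_prop)
    (fun θ _ => by
      rw [h _ (exp_ne_zero _), exp_add, h 1 one_ne_zero, mul_one])
    (mem_univ 0) (by simp) (2 * Real.pi) (mem_univ _)
  have h2 : exp (((2 * Real.pi : ℝ) : ℂ) * I) = 1 := by
    push_cast
    exact exp_two_pi_mul_I
  simp only [h2] at h1
  have h3 : ((2 * Real.pi : ℝ) : ℂ) * I = 0 := by linear_combination -h1
  simp [Real.pi_ne_zero] at h3

lemma exists_continuous_log {u : ℂ → ℂ} (hu : Continuous u) (h0 : ∀ t, u t ≠ 0) :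
    ∃ a : ℂ → ℂ, Continuous a ∧ ∀ t, exp (a t) = u t := by
  obtain ⟨a, hac, ha⟩ := exists_continuousOn_eqOn_exp_comp (U := (univ : Set ℂ)) (g := u)
    ((Homeomorph.Set.univ ℂ).toHomotopyEquiv.simplyConnectedSpace_iff.2 inferInstance) isOpen_univ
      hu.continuousOn (by simpa using h0)
  exact ⟨a, continuousOn_univ.1 hac, fun t => ha (mem_univ t)⟩


lemma LineAcyclic.false_of_full_pencil {D : Set E} (hDo : IsOpen D) (hD : LineAcyclic D)
    (x y : E →L[ℂ] ℂ) (ex ey : E) (hxx : x ex = 1) (hyx : y ex = 0) (hxy : x ey = 0)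
    (hyy : y ey = 1) (h0 : ∀ w ∈ D, x w = 0 → y w ≠ 0)
    (hs : ∀ α β : ℂ, (α ≠ 0 ∨ β ≠ 0) → ∃ w ∈ D, ∃ c : ℂ, x w = c * α ∧ y w = c * β) : False := by
  have hs1 : ∀ t : ℂ, ∃ w ∈ D, x w ≠ 0 ∧ y w / x w = t := fun t => by
    obtain ⟨w, hw, c, h1, h2⟩ := hs 1 t (by simp)
    have hc : c ≠ 0 := by
      rintro rfl
      exact h0 w hw (by simpa using h1) (by simpa using h2)
    refine ⟨w, hw, by simpa [h1] using hc, ?_⟩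
    rw [h1, h2]; field_simp
  have hs2 : ∀ t : ℂ, ∃ w ∈ D, y w ≠ 0 ∧ x w / y w = t := fun t => by
    obtain ⟨w, hw, c, h1, h2⟩ := hs t 1 (by simp)
    have hc : c ≠ 0 := by
      rintro rfl
      exact h0 w hw (by simpa using h1) (by simpa using h2)
    refine ⟨w, hw, by simpa [h2] using hc, ?_⟩
    rw [h1, h2]; field_simp
  obtain ⟨M, u, hM, hu, hu0, hMu⟩ := hD.exists_chart hDo x y ey hxy hyy h0 hs1
  obtain ⟨N, v, hN, hv, hv0, hNv⟩ := hD.exists_chart hDo y x ex hyx hxx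
    (fun w hw h h' => h0 w hw h' h) hs2
  obtain ⟨a, hac, ha⟩ := exists_continuous_log hu hu0
  obtain ⟨b, hbc, hb⟩ := exists_continuous_log hv hv0
  have hMN : ∀ w ∈ D, x w ≠ 0 → y w ≠ 0 →
      exp (N w - M w) = (y w / x w) * u (y w / x w) / v ((y w / x w)⁻¹) := by
    intro w hw hxw hyw
    rw [exp_sub, inv_div, div_eq_div_iff (exp_ne_zero _) (hv0 _)]
    have h1 := hMu w hw hxw
    have h2 := hNv w hw hyw
    rw [div_mul_eq_mul_div, div_mul_eq_mul_div, eq_div_iff hxw]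
    rw [mul_assoc (y w), ← h1, mul_comm (exp _), ← h2]
  have hfib : ∀ w ∈ D, ∀ w' ∈ D, x w ≠ 0 → x w' ≠ 0 → y w ≠ 0 → y w / x w = y w' / x w' →
      N w - M w = N w' - M w' := by
    intro w hw w' hw' hxw hxw' hyw hww'
    set t := y w / x w with ht
    have hpre := (hD.hasLogs_inter hDo (LinearMap.ker (y - t • x : E →L[ℂ] ℂ).toLinearMap)).1
    have ht0 : t ≠ 0 := div_ne_zero hyw hxw
    have hmem : ∀ v ∈ D, x v ≠ 0 → y v / x v = t →
        v ∈ D ∩ (LinearMap.ker (y - t • x : E →L[ℂ] ℂ).toLinearMap : Submodule ℂ E) := by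
      intro v hv hxv hvt
      refine ⟨hv, ?_⟩
      have : y v = t * x v := by rw [← hvt]; field_simp
      simp [this]
    have hmem' : ∀ v ∈ D ∩ (LinearMap.ker (y - t • x : E →L[ℂ] ℂ).toLinearMap : Submodule ℂ E),
        v ∈ D ∧ x v ≠ 0 ∧ y v ≠ 0 ∧ y v / x v = t := by
      rintro v ⟨hv, hvK⟩
      have hyv : y v = t * x v := by simpa [sub_eq_zero] using hvK
      have hxv : x v ≠ 0 := fun h => h0 v hv h (by rw [hyv, h, mul_zero])
      exact ⟨hv, hxv, by rw [hyv]; exact mul_ne_zero ht0 hxv,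
        by rw [hyv, mul_div_cancel_right₀ _ hxv]⟩
    have := eqOn_of_exp_eqOn hpre (g₁ := fun v => N v - M v) (g₂ := fun _ => N w - M w)
      (fun v hv => ((hN v (hmem' v hv).1 (hmem' v hv).2.2.1).sub
        (hM v (hmem' v hv).1 (hmem' v hv).2.1)).continuousWithinAt)
      continuousOn_const
      (fun v hv => by
          rw [hMN v (hmem' v hv).1 (hmem' v hv).2.1 (hmem' v hv).2.2.1, (hmem' v hv).2.2.2,
          hMN w hw hxw hyw])
      (hmem w hw hxw rfl) rfl w' (hmem w' hw' hxw' hww'.symm)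
    exact this.symm
  choose w₀ hw₀ hx₀ ht₀ using hs1
  have hy₀ : ∀ t, t ≠ 0 → y (w₀ t) ≠ 0 := fun t ht h => ht (by rw [← ht₀ t, h, zero_div])
  set g : ℂ → ℂ := fun t => N (w₀ t) - M (w₀ t) with hg
  have hgc : ContinuousOn g {0}ᶜ := by
    intro t₀ ht0
    refine ContinuousAt.continuousWithinAt ?_
    have ht0' : t₀ ≠ 0 := ht0
    set s : ℂ → E := fun t => w₀ t₀ + ((t - t₀) * x (w₀ t₀)) • ey with hs
    have hsc : Continuous s := by fun_prop
    have hs0 : s t₀ = w₀ t₀ := by simp [hs]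
    have hxs : ∀ t, x (s t) = x (w₀ t₀) := fun t => by simp [hs, hxy]
    have hτs : ∀ t, y (s t) / x (s t) = t := fun t => by
      have h1 := hx₀ t₀
      have h2 : y (w₀ t₀) = t₀ * x (w₀ t₀) := (div_eq_iff h1).1 (ht₀ t₀)
      simp only [hxs]
      simp only [hs, map_add, map_smul, hyy, smul_eq_mul, mul_one, h2]
      field_simp
      ring
    have hev : ∀ᶠ t in 𝓝 t₀, g t = N (s t) - M (s t) := by
      have h1 : ∀ᶠ t in 𝓝 t₀, s t ∈ D :=
        hsc.continuousAt.eventually_mem (by rw [hs0]; exact hDo.mem_nhds (hw₀ t₀))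
      filter_upwards [h1, eventually_ne_nhds ht0'] with t ht htn
      exact hfib _ (hw₀ t) _ ht (hx₀ t) (by rw [hxs]; exact hx₀ t₀) (hy₀ t htn)
        (by rw [hτs]; exact ht₀ t)
    refine ContinuousAt.congr ?_ (hev.mono fun t ht => ht.symm)
    exact (ContinuousAt.comp (g := N) (f := s)
        (by rw [hs0]; exact hN _ (hw₀ t₀) (hy₀ t₀ ht0')) hsc.continuousAt).sub
      (ContinuousAt.comp (g := M) (f := s)
        (by rw [hs0]; exact hM _ (hw₀ t₀) (hx₀ t₀)) hsc.continuousAt)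
  refine not_exists_log_compl_zero (L := fun t => g t + b t⁻¹ - a t)
    ((hgc.add (hbc.comp_continuousOn (continuousOn_inv₀))).sub hac.continuousOn) fun t ht => ?_
  have := hMN (w₀ t) (hw₀ t) (hx₀ t) (hy₀ t ht)
  rw [ht₀] at this
  simp only [exp_sub, exp_add, ha, hb, hg] at this ⊢
  rw [this, div_mul_cancel₀ _ (hv0 _), mul_div_cancel_right₀ _ (hu0 _)]

lemma hasLogs_of_isSimplyConnected {U : Set ℂ} (hU : IsOpen U) (h : IsSimplyConnected U) :
    HasLogs U := by
  refine ⟨h.isPathConnected.isConnected.isPreconnected, fun f hf hf0 => ?_⟩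
  obtain ⟨L, hL, hLf⟩ := exists_continuousOn_eqOn_exp_comp h hU hf
    (by rintro ⟨x, hx, hx0⟩; exact hf0 x hx hx0)
  exact ⟨L, hL, hLf⟩

lemma isEmbedding_affine (z X : E) (hX : X ≠ 0) :
    Topology.IsEmbedding fun l : ℂ => z + l • X :=
  (Homeomorph.addLeft z).isEmbedding.comp (isClosedEmbedding_smul_left hX).isEmbedding

lemma lineAcyclic_of_isSimplyConnected {D : Set E} (hDo : IsOpen D)
    (h : ∀ z X : E, X ≠ 0 → (D ∩ affineLine z X).Nonempty →
      IsSimplyConnected (D ∩ affineLine z X)) : LineAcyclic D := by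
  intro z X hX
  rcases (D ∩ affineLine z X).eq_empty_or_nonempty with he | hne
  · rw [he]; exact hasLogs_empty
  have hemb := isEmbedding_affine z X hX
  have heq : (fun l : ℂ => z + l • X) '' ((fun l : ℂ => z + l • X) ⁻¹' D) =
      D ∩ affineLine z X := by
    rw [image_preimage_eq_inter_range]; rfl
  have := h z X hX hne
  rw [← heq, hemb.isSimplyConnected_image] at this
  rw [← heq, hasLogs_image_iff hemb]
  exact hasLogs_of_isSimplyConnected (hDo.preimage hemb.continuous) this

/-- A point outside an open line-acyclic set lies on a hyperplane avoiding the set. -/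
lemma LineAcyclic.exists_ne_zero [FiniteDimensional ℂ E] {D : Set E} (hDo : IsOpen D)
    (hD : LineAcyclic D) (h0 : (0 : E) ∉ D) : ∃ ℓ : E →L[ℂ] ℂ, ∀ w ∈ D, ℓ w ≠ 0 := by
  rcases D.eq_empty_or_nonempty with rfl | ⟨p, hp⟩
  · exact ⟨0, by simp⟩
  obtain ⟨A, hA, hmax⟩ := (wellFounded_gt (α := Submodule ℂ E)).has_min
    {A | ∀ w ∈ D, w ∉ A} ⟨⊥, fun w hw h => h0 (by rwa [(Submodule.mem_bot ℂ).1 h] at hw)⟩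
  have hA : ∀ w ∈ D, w ∉ A := hA
  have hmeet : ∀ v, v ∉ A → ∃ w ∈ D, w ∈ A ⊔ Submodule.span ℂ {v} := by
    intro v hv
    by_contra! hcon
    refine hmax _ hcon (lt_of_le_of_ne le_sup_left fun h => hv ?_)
    rw [h]
    exact (le_sup_right : _ ≤ A ⊔ Submodule.span ℂ {v}) (Submodule.mem_span_singleton_self v)
  obtain ⟨ℓ, hℓ0, hℓA⟩ := Submodule.exists_le_ker_of_lt_top A
    (lt_top_iff_ne_top.2 fun h => hA p hp (by rw [h]; trivial))
  by_cases hker : LinearMap.ker ℓ ≤ A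
  · exact ⟨ℓ.toContinuousLinearMap, fun w hw h => hA w hw (hker h)⟩
  exfalso
  obtain ⟨Y, hYℓ, hYA⟩ := SetLike.not_le_iff_exists.1 hker
  obtain ⟨y, hyY, hyA⟩ := Submodule.exists_le_ker_of_notMem hYA
  have hℓA : ∀ a ∈ A, ℓ a = 0 := fun a ha => hℓA ha
  have hyA : ∀ a ∈ A, y a = 0 := fun a ha => hyA ha
  have hYℓ : ℓ Y = 0 := hYℓ
  obtain ⟨X, hX⟩ : ∃ X, ℓ X ≠ 0 := by
    by_contra! h
    exact hℓ0 (LinearMap.ext h)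
  set eY : E := (y Y)⁻¹ • Y with heY
  set eX : E := (ℓ X)⁻¹ • X - ((ℓ X)⁻¹ * y X) • eY with heX
  have hyey : y eY = 1 := by simp [heY, hyY]
  have hxey : ℓ eY = 0 := by simp [heY, hYℓ]
  have hxex : ℓ eX = 1 := by simp [heX, hxey, hX]
  have hyex : y eX = 0 := by simp [heX, hyey]
  set P : Submodule ℂ E := A ⊔ Submodule.span ℂ {eX, eY} with hP
  have heXP : eX ∈ P := Submodule.mem_sup_right (Submodule.subset_span (by simp))
  have heYP : eY ∈ P := Submodule.mem_sup_right (Submodule.subset_span (by simp))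
  refine (hD.preimage_subtype P).false_of_full_pencil (hDo.preimage continuous_subtype_val)
    (ℓ.toContinuousLinearMap.comp P.subtypeL) (y.toContinuousLinearMap.comp P.subtypeL)
    ⟨eX, heXP⟩ ⟨eY, heYP⟩ (by simpa using hxex) (by simpa using hyex) (by simpa using hxey)
    (by simpa using hyey) ?_ ?_
  · rintro ⟨w, hwP⟩ hw hxw hyw
    have hxw : ℓ w = 0 := hxw
    have hyw : y w = 0 := hyw
    obtain ⟨a, ha, b, hb, rfl⟩ := Submodule.mem_sup.1 hwP
    obtain ⟨c, d, rfl⟩ := Submodule.mem_span_pair.1 hb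
    simp [hℓA a ha, hxex, hxey] at hxw
    simp [hyA a ha, hyex, hyey] at hyw
    refine hA _ hw ?_
    simpa [hxw, hyw] using ha
  · intro α β hαβ
    obtain ⟨w, hw, hwA⟩ := hmeet (α • eX + β • eY) (fun h => by
      have h1 := hℓA _ h
      have h2 := hyA _ h
      simp [hxex, hxey] at h1
      simp [hyex, hyey] at h2
      simp [h1, h2] at hαβ)
    obtain ⟨a, ha, b, hb, rfl⟩ := Submodule.mem_sup.1 hwA
    obtain ⟨c, rfl⟩ := Submodule.mem_span_singleton.1 hb
    refine ⟨⟨a + c • (α • eX + β • eY), P.add_mem (Submodule.mem_sup_left ha) (P.smul_mem _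
      (P.add_mem (P.smul_mem _ heXP) (P.smul_mem _ heYP)))⟩, hw, c, ?_, ?_⟩
    · simp [hℓA a ha, hxex, hxey]
    · simp [hyA a ha, hyex, hyey]

/-- Linear convexity: through any point outside there is a hyperplane avoiding the set. -/
lemma LineAcyclic.exists_apply_ne [FiniteDimensional ℂ E] {D : Set E} (hDo : IsOpen D)
    (hD : LineAcyclic D) {a : E} (ha : a ∉ D) : ∃ ℓ : E →L[ℂ] ℂ, ∀ w ∈ D, ℓ w ≠ ℓ a := by
  obtain ⟨ℓ, hℓ⟩ := (hD.preimage_add a).exists_ne_zero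
    (hDo.preimage (by fun_prop : Continuous fun w => w + a)) (by simpa using ha)
  refine ⟨ℓ, fun w hw h => hℓ (w - a) (by simpa using hw) (by simp [h])⟩

/-- On a linear image of a line-acyclic set there are continuous square roots. -/
lemma LineAcyclic.exists_sqrt {D : Set E} (hDo : IsOpen D) (hD : LineAcyclic D)
    (ℓ : E →L[ℂ] ℂ) {e : E} (he : ℓ e = 1) {d : ℂ} (hd : ∀ w ∈ D, ℓ w ≠ d) :
    ∃ s : ℂ → ℂ, ContinuousOn s (ℓ '' D) ∧ ∀ c ∈ ℓ '' D, s c ^ 2 = c - d := by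
  obtain ⟨-, hlog⟩ := hD.hasLogs hDo
  obtain ⟨L, hL, hLe⟩ := hlog (fun w => ℓ w - d) (by fun_prop) fun w hw => sub_ne_zero.2 (hd w hw)
  have hfib : ∀ w ∈ D, ∀ w' ∈ D, ℓ w = ℓ w' → L w = L w' := by
    intro w hw w' hw' h
    by_cases hww' : w' - w = 0
    · rw [sub_eq_zero.1 hww']
    have hpre := (hD w (w' - w) hww').1
    have hconst : ∀ v ∈ affineLine w (w' - w), ℓ v = ℓ w := by
      rintro _ ⟨l, rfl⟩
      simp [h]
    exact (eqOn_of_exp_eqOn hpre (g₁ := L) (g₂ := fun _ => L w)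
      (hL.mono inter_subset_left) continuousOn_const
      (fun v hv => by rw [hLe v hv.1, hLe w hw, hconst v hv.2])
      ⟨hw, mem_affineLine_self _ _⟩ rfl w' ⟨hw', mem_affineLine_sub _ _⟩).symm
  choose! σ hσ hℓσ using fun c (hc : c ∈ ℓ '' D) => hc
  refine ⟨fun c => exp (L (σ c) / 2), ?_, fun c hc => ?_⟩
  · intro c₀ hc₀
    refine ContinuousAt.continuousWithinAt ?_
    set p : ℂ → E := fun c => σ c₀ + (c - c₀) • e with hp
    have hpc : Continuous p := by fun_prop
    have hp0 : p c₀ = σ c₀ := by simp [hp]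
    have hℓp : ∀ c, ℓ (p c) = c := fun c => by simp [hp, hℓσ c₀ hc₀, he]
    have hev : ∀ᶠ c in 𝓝 c₀, L (σ c) = L (p c) := by
      have h1 : ∀ᶠ c in 𝓝 c₀, p c ∈ D :=
        hpc.continuousAt.eventually_mem (by rw [hp0]; exact hDo.mem_nhds (hσ c₀ hc₀))
      filter_upwards [h1] with c hc
      have hcm : c ∈ ℓ '' D := ⟨p c, hc, hℓp c⟩
      exact hfib _ (hσ c hcm) _ hc (by rw [hℓσ c hcm, hℓp])
    have h2 : ContinuousAt (fun c => L (p c)) c₀ :=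
      ContinuousAt.comp (g := L) (f := p)
        (by rw [hp0]; exact hL.continuousAt (hDo.mem_nhds (hσ c₀ hc₀))) hpc.continuousAt
    have h3 : ContinuousAt (fun c => L (σ c)) c₀ := h2.congr (hev.mono fun c hc => hc.symm)
    exact (h3.div_const 2).cexp
  · rw [← exp_nat_mul]
    rw [show ((2 : ℕ) : ℂ) * (L (σ c) / 2) = L (σ c) by push_cast; ring, hLe _ (hσ c hc),
      hℓσ c hc]

end

/-- The real Jacobian determinant of a holomorphic function of one variable. -/
lemma lintegral_image_eq_lintegral_enorm_deriv {G : Set ℂ} (hG : MeasurableSet G) {f f' : ℂ → ℂ}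
    (hf : ∀ z ∈ G, HasDerivAt f (f' z) z) (hinj : InjOn f G) (g : ℂ → ℝ≥0∞) :
    ∫⁻ w in f '' G, g w = ∫⁻ z in G, ‖f' z‖ₑ ^ 2 * g (f z) := by
  rw [lintegral_image_eq_lintegral_abs_det_fderiv_mul volume hG
    (f' := fun z => (ContinuousLinearMap.toSpanSingleton ℂ (f' z)).restrictScalars ℝ)
    (fun z hz => ((hf z hz).hasFDerivAt.restrictScalars ℝ).hasFDerivWithinAt) hinj]
  congr with z
  congr 1
  have : ((ContinuousLinearMap.toSpanSingleton ℂ (f' z)).restrictScalars ℝ).det = ‖f' z‖ ^ 2 := by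
    simp [ContinuousLinearMap.det, LinearMap.det_restrictScalars, Algebra.norm_complex_eq,
      Complex.normSq_eq_norm_sq]
  rw [this, abs_of_nonneg (by positivity), ENNReal.ofReal_pow (norm_nonneg _), ofReal_norm]

/-- A smooth version of the Cauchy transform of the indicator function of a disc. -/
lemma exists_disc_potential {ρ ε : ℝ} (hρ : 0 < ρ) (hε : 0 < ε) (hε1 : ε < 1) :
    ∃ (F α β : ℂ → ℂ) (a : ℝ), ContDiff ℝ 2 F ∧
      (∀ z v, fderiv ℝ F z v = α z * v + β z * (starRingEnd ℂ) v) ∧ (∀ z, ‖β z‖ ≤ 1) ∧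
      (∀ z, ρ < ‖z‖ → β z = 0 ∧ α z = -a / z ^ 2 ∧ F z = a / z) ∧ (1 - ε) * ρ ^ 2 ≤ a := by
  have hρ2 : 0 < ρ ^ 2 := by positivity
  let χ : ContDiffBump (0 : ℝ) := ⟨(1 - ε) * ρ ^ 2, ρ ^ 2, by nlinarith, by nlinarith⟩
  have hχc : Continuous χ := χ.continuous
  set Φ : ℝ → ℝ := fun s => ∫ t in (0 : ℝ)..s, χ t with hΦ
  have hΦd : ∀ s, HasDerivAt Φ (χ s) s := fun s =>
    intervalIntegral.integral_hasDerivAt_right (hχc.intervalIntegrable _ _)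
      hχc.stronglyMeasurable.stronglyMeasurableAtFilter hχc.continuousAt
  have hΦc : ContDiff ℝ 2 Φ := by
    rw [show (2 : WithTop ℕ∞) = 1 + 1 from rfl, contDiff_succ_iff_deriv]
    refine ⟨fun s => (hΦd s).differentiableAt, by simp, ?_⟩
    rw [show deriv Φ = χ from funext fun s => (hΦd s).deriv]
    exact χ.contDiff
  have hΦ1 : ∀ s, 0 ≤ s → s ≤ (1 - ε) * ρ ^ 2 → Φ s = s := by
    intro s hs0 hs
    have : Φ s = ∫ t in (0 : ℝ)..s, (1 : ℝ) := by
      refine intervalIntegral.integral_congr fun t ht => ?_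
      rw [uIcc_of_le hs0] at ht
      refine χ.one_of_mem_closedBall ?_
      rw [mem_closedBall, Real.dist_eq, sub_zero, abs_of_nonneg ht.1]
      exact ht.2.trans hs
    simp [this]
  have hχ0 : ∀ s, ρ ^ 2 ≤ s → χ s = 0 := fun s hs => χ.zero_of_le_dist (by
    rw [Real.dist_eq, sub_zero]; exact hs.trans (le_abs_self s))
  have hΦ2 : ∀ s, ρ ^ 2 ≤ s → Φ s = Φ (ρ ^ 2) := by
    intro s hs
    have h1 : Φ s = Φ (ρ ^ 2) + ∫ t in (ρ ^ 2)..s, χ t :=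
      (intervalIntegral.integral_add_adjacent_intervals (hχc.intervalIntegrable _ _)
        (hχc.intervalIntegrable _ _)).symm
    have h2 : ∫ t in (ρ ^ 2)..s, χ t = ∫ t in (ρ ^ 2)..s, (0 : ℝ) := by
      refine intervalIntegral.integral_congr fun t ht => ?_
      rw [uIcc_of_le hs] at ht
      exact hχ0 t ht.1
    rw [h1, h2]; simp
  have ha : (1 - ε) * ρ ^ 2 ≤ Φ (ρ ^ 2) := by
    have h1 : Φ (ρ ^ 2) = Φ ((1 - ε) * ρ ^ 2) + ∫ t in ((1 - ε) * ρ ^ 2)..(ρ ^ 2), χ t :=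
      (intervalIntegral.integral_add_adjacent_intervals (hχc.intervalIntegrable _ _)
        (hχc.intervalIntegrable _ _)).symm
    have h2 : 0 ≤ ∫ t in ((1 - ε) * ρ ^ 2)..(ρ ^ 2), χ t :=
      intervalIntegral.integral_nonneg (by nlinarith) fun t _ => χ.nonneg
    rw [hΦ1 _ (by nlinarith) le_rfl] at h1
    linarith
  set F : ℂ → ℂ := fun z => (Φ (normSq z) : ℂ) / z with hF
  have hF0 : F =ᶠ[𝓝 0] fun z => (starRingEnd ℂ) z := by
    have : ∀ᶠ z : ℂ in 𝓝 0, normSq z < (1 - ε) * ρ ^ 2 :=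
      Complex.continuous_normSq.continuousAt.eventually_lt_const (by simp; nlinarith)
    filter_upwards [this] with z hz
    rcases eq_or_ne z 0 with rfl | hz0
    · simp [hF]
    · simp only [hF]
      rw [hΦ1 _ (normSq_nonneg z) hz.le, div_eq_iff hz0, mul_comm, mul_conj]
  have hnsq : ContDiff ℝ 2 (fun z : ℂ => normSq z) := by
    simp only [normSq_apply]
    exact ((reCLM.contDiff).mul reCLM.contDiff).add (imCLM.contDiff.mul imCLM.contDiff)
  have hFc : ContDiff ℝ 2 F := by
    rw [contDiff_iff_contDiffAt]
    intro z
    rcases eq_or_ne z 0 with rfl | hz0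
    · exact conjCLE.contDiff.contDiffAt.congr_of_eventuallyEq hF0
    · exact ((ofRealCLM.contDiff.comp (hΦc.comp hnsq)).contDiffAt).mul (contDiffAt_inv ℝ hz0)
  refine ⟨F, fun z => if z = 0 then 0 else
    χ (normSq z) * (starRingEnd ℂ) z / z - Φ (normSq z) / z ^ 2, fun z => χ (normSq z),
    Φ (ρ ^ 2), hFc, fun z v => ?_, fun z => ?_, fun z hz => ?_, ha⟩
  · rcases eq_or_ne z 0 with rfl | hz0
    · rw [hF0.fderiv_eq]
      have h1 : χ (normSq 0) = 1 := χ.one_of_mem_closedBall (by simp; nlinarith)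
      have h2 : fderiv ℝ (fun z : ℂ => (starRingEnd ℂ) z) 0 = (conjCLE : ℂ →L[ℝ] ℂ) :=
        conjCLE.toContinuousLinearMap.fderiv
      beta_reduce
      rw [h2, h1]
      simp
    · have h1 : HasFDerivAt (fun z : ℂ => normSq z)
          (z.re • reCLM + z.re • reCLM + (z.im • imCLM + z.im • imCLM)) z := by
        simp only [normSq_apply]
        exact (reCLM.hasFDerivAt.mul reCLM.hasFDerivAt).add
          (imCLM.hasFDerivAt.mul imCLM.hasFDerivAt)
      have h2 := ofRealCLM.hasFDerivAt.comp z ((hΦd (normSq z)).hasFDerivAt.comp z h1)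
      have h3 := h2.mul' ((hasDerivAt_inv hz0).hasFDerivAt.restrictScalars ℝ)
      have h4 : HasFDerivAt F _ z := h3.congr_of_eventuallyEq (.of_forall fun w => rfl)
      rw [h4.fderiv]
      have hc : ((z.re * v.re + z.im * v.im : ℝ) : ℂ) * 2 =
          (starRingEnd ℂ) z * v + z * (starRingEnd ℂ) v := by
        apply Complex.ext <;> simp <;> ring
      simp [hz0]
      have hzz : z * z⁻¹ = 1 := mul_inv_cancel₀ hz0
      push_cast at hc
      rw [div_eq_mul_inv, div_eq_mul_inv]
      linear_combination (χ (normSq z) : ℂ) * z⁻¹ * hc +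
        (χ (normSq z) : ℂ) * (starRingEnd ℂ) v * hzz
  · rw [Complex.norm_real, Real.norm_eq_abs, abs_of_nonneg χ.nonneg]
    exact χ.le_one
  · have hz0 : z ≠ 0 := by
      rintro rfl
      simp at hz; linarith
    have h1 : ρ ^ 2 ≤ normSq z := by
      rw [normSq_eq_norm_sq]; gcongr
    simp [hz0, hχ0 _ h1, hΦ2 _ h1, hF, neg_div]

/-- The Beurling transform is an isometry: the `L²` norms of the two Wirtinger derivatives of a
function which decays at infinity agree. -/
lemma integral_wirtinger_eq {F α β : ℂ → ℂ} (hF : ContDiff ℝ 2 F)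
    (hαβ : ∀ z v, fderiv ℝ F z v = α z * v + β z * (starRingEnd ℂ) v)
    (h0 : F =O[Filter.cocompact ℂ] fun z => (1 + ‖z‖) ^ (-1 : ℝ))
    (h1 : (fderiv ℝ F) =O[Filter.cocompact ℂ] fun z => (1 + ‖z‖) ^ (-2 : ℝ))
    (h2 : (fderiv ℝ (fderiv ℝ F)) =O[Filter.cocompact ℂ] fun z => (1 + ‖z‖) ^ (-2 : ℝ)) :
    Integrable (fun z => ‖α z‖ ^ 2) ∧ ∫ z, ‖α z‖ ^ 2 = ∫ z, ‖β z‖ ^ 2 := by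
  have hg : ∀ r : ℝ, 2 < r → Integrable fun z : ℂ => (1 + ‖z‖) ^ (-r) := fun r hr =>
    integrable_one_add_norm (by simpa using hr)
  have hintegral : ∀ (r : ℝ), 2 < r → ∀ f : ℂ → ℂ, Continuous f →
      (f =O[Filter.cocompact ℂ] fun z => (1 + ‖z‖) ^ (-r)) → Integrable f := fun r hr f hf ho =>
    hf.locallyIntegrable.integrable_of_isBigO_cocompact ho ((hg r hr).integrableAtFilter _)
  have hmul : ∀ (f g : ℂ → ℂ) (r s : ℝ), (f =O[Filter.cocompact ℂ] fun z => (1 + ‖z‖) ^ (-r)) →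
      (g =O[Filter.cocompact ℂ] fun z => (1 + ‖z‖) ^ (-s)) →
      (fun z => f z * g z) =O[Filter.cocompact ℂ] fun z => (1 + ‖z‖) ^ (-(r + s)) := by
    intro f g r s hf hg
    refine (hf.mul hg).congr_right fun z => ?_
    rw [← Real.rpow_add (by positivity), neg_add]
  have hF1 : ContDiff ℝ 1 (fderiv ℝ F) := hF.fderiv_right (by norm_num)
  have hF2 : Continuous (fderiv ℝ (fderiv ℝ F)) := hF1.continuous_fderiv one_ne_zero
  -- directional derivatives and their bounds
  have hdir : ∀ v, (fun z => (starRingEnd ℂ) (fderiv ℝ F z v)) =O[Filter.cocompact ℂ]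
      fun z => (1 + ‖z‖) ^ (-2 : ℝ) := fun v => by
    refine Asymptotics.IsBigO.trans (g := fderiv ℝ F) ?_ h1
    refine Asymptotics.IsBigO.of_bound ‖v‖ (.of_forall fun z => ?_)
    rw [RCLike.norm_conj, mul_comm]
    exact ContinuousLinearMap.le_opNorm _ _
  have hdir' : ∀ v, (fun z => fderiv ℝ F z v) =O[Filter.cocompact ℂ]
      fun z => (1 + ‖z‖) ^ (-2 : ℝ) := fun v => by
    refine Asymptotics.IsBigO.trans (g := fderiv ℝ F) ?_ h1
    refine Asymptotics.IsBigO.of_bound ‖v‖ (.of_forall fun z => ?_)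
    rw [mul_comm]
    exact ContinuousLinearMap.le_opNorm _ _
  have hdirc : ∀ v, ContDiff ℝ 1 fun z => (starRingEnd ℂ) (fderiv ℝ F z v) := fun v =>
    conjCLE.contDiff.comp (hF1.clm_apply contDiff_const)
  have hdird : ∀ z v w, fderiv ℝ (fun z => (starRingEnd ℂ) (fderiv ℝ F z v)) z w =
      (starRingEnd ℂ) (fderiv ℝ (fderiv ℝ F) z w v) := by
    intro z v w
    have h3 : HasFDerivAt (fderiv ℝ F) (fderiv ℝ (fderiv ℝ F) z) z :=
      (hF1.differentiable one_ne_zero z).hasFDerivAt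
    have h4 := conjCLE.toContinuousLinearMap.hasFDerivAt.comp z
      (h3.clm_apply (hasFDerivAt_const v z))
    have h5 : HasFDerivAt (fun z => (starRingEnd ℂ) (fderiv ℝ F z v)) _ z := h4
    rw [h5.fderiv]
    simp
  have hsnd : ∀ v w, (fun z => (starRingEnd ℂ) (fderiv ℝ (fderiv ℝ F) z w v))
      =O[Filter.cocompact ℂ] fun z => (1 + ‖z‖) ^ (-2 : ℝ) := fun v w => by
    refine Asymptotics.IsBigO.trans (g := fderiv ℝ (fderiv ℝ F)) ?_ h2
    refine Asymptotics.IsBigO.of_bound (‖w‖ * ‖v‖) (.of_forall fun z => ?_)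
    rw [RCLike.norm_conj]
    calc ‖fderiv ℝ (fderiv ℝ F) z w v‖ ≤ ‖fderiv ℝ (fderiv ℝ F) z w‖ * ‖v‖ :=
          ContinuousLinearMap.le_opNorm _ _
      _ ≤ ‖fderiv ℝ (fderiv ℝ F) z‖ * ‖w‖ * ‖v‖ := by
          gcongr; exact ContinuousLinearMap.le_opNorm _ _
      _ = _ := by ring
  have hFdc : ∀ v, Continuous fun z => fderiv ℝ F z v := fun v =>
    hF1.continuous.clm_apply continuous_const
  have hibp : ∀ v w, ∫ z, F z * (starRingEnd ℂ) (fderiv ℝ (fderiv ℝ F) z w v) =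
      -∫ z, fderiv ℝ F z w * (starRingEnd ℂ) (fderiv ℝ F z v) := by
    intro v w
    have := integral_mul_fderiv_eq_neg_fderiv_mul_of_integrable (𝕜 := ℂ) (μ := (volume : Measure ℂ))
      (f := F) (g := fun z => (starRingEnd ℂ) (fderiv ℝ F z v)) (v := w)
      (hintegral (2 + 2) (by norm_num) _ ((hFdc w).mul (hdirc v).continuous)
        (hmul _ _ _ _ (hdir' w) (hdir v)))
      (hintegral (1 + 2) (by norm_num) _ (hF.continuous.mul
        (((hdirc v).continuous_fderiv one_ne_zero).clm_apply continuous_const))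
        (hmul _ _ _ _ h0 ((hsnd v w).congr_left fun z => (hdird z v w).symm)))
      (hintegral (1 + 2) (by norm_num) _ (hF.continuous.mul (hdirc v).continuous)
        (hmul _ _ _ _ h0 (hdir v)))
      (fun x _ => hF.differentiable two_ne_zero x)
      (fun x _ => (hdirc v).differentiable one_ne_zero x)
    simpa only [hdird] using this
  have hsymm : ∀ z v w, fderiv ℝ (fderiv ℝ F) z w v = fderiv ℝ (fderiv ℝ F) z v w :=
    fun z v w => (hF.contDiffAt.isSymmSndFDerivAt (by simp)) w v
  have hα : ∀ z, α z = (fderiv ℝ F z 1 - I * fderiv ℝ F z I) / 2 := by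
    intro z
    rw [hαβ, hαβ]
    simp
    linear_combination (α z / 2 - β z / 2) * I_sq
  have hβ : ∀ z, β z = (fderiv ℝ F z 1 + I * fderiv ℝ F z I) / 2 := by
    intro z
    rw [hαβ, hαβ]
    simp
    linear_combination (β z / 2 - α z / 2) * I_sq
  have hintm : ∀ v w, Integrable fun z => fderiv ℝ F z w * (starRingEnd ℂ) (fderiv ℝ F z v) :=
    fun v w => hintegral (2 + 2) (by norm_num) _ ((hFdc w).mul (hdirc v).continuous)
      (hmul _ _ _ _ (hdir' w) (hdir v))
  have hcross : ∫ z, fderiv ℝ F z 1 * (starRingEnd ℂ) (fderiv ℝ F z I) =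
      ∫ z, fderiv ℝ F z I * (starRingEnd ℂ) (fderiv ℝ F z 1) := by
    have e1 := hibp I 1
    have e2 := hibp 1 I
    simp only [hsymm _ 1 I] at e2
    rw [e1] at e2
    exact neg_injective e2
  have hdiff : ∀ z, ((‖α z‖ ^ 2 : ℝ) : ℂ) - ((‖β z‖ ^ 2 : ℝ) : ℂ) =
      I / 2 * (fderiv ℝ F z 1 * (starRingEnd ℂ) (fderiv ℝ F z I) -
        fderiv ℝ F z I * (starRingEnd ℂ) (fderiv ℝ F z 1)) := by
    intro z
    push_cast
    rw [← mul_conj', ← mul_conj', hα, hβ]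
    simp only [map_div₀, map_sub, map_add, map_mul, conj_I, map_ofNat]
    linear_combination (0:ℂ) * I_sq
  have hsq : ∀ (f : ℂ → ℂ), (∃ a b : ℂ, ∀ z, f z = a * fderiv ℝ F z 1 + b * fderiv ℝ F z I) →
      Integrable fun z => ((‖f z‖ ^ 2 : ℝ) : ℂ) := by
    rintro f ⟨a, b, hf⟩
    have : (fun z => ((‖f z‖ ^ 2 : ℝ) : ℂ)) = fun z =>
        (a * (starRingEnd ℂ) a) * (fderiv ℝ F z 1 * (starRingEnd ℂ) (fderiv ℝ F z 1)) +
        (a * (starRingEnd ℂ) b) * (fderiv ℝ F z 1 * (starRingEnd ℂ) (fderiv ℝ F z I)) +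
        (b * (starRingEnd ℂ) a) * (fderiv ℝ F z I * (starRingEnd ℂ) (fderiv ℝ F z 1)) +
        (b * (starRingEnd ℂ) b) * (fderiv ℝ F z I * (starRingEnd ℂ) (fderiv ℝ F z I)) := by
      funext z
      push_cast
      rw [← mul_conj', hf]
      simp
      ring
    rw [this]
    exact ((((hintm 1 1).const_mul _).add ((hintm I 1).const_mul _)).add
      ((hintm 1 I).const_mul _)).add ((hintm I I).const_mul _)
  have hαi := hsq α ⟨1 / 2, -I / 2, fun z => by rw [hα]; ring⟩
  have hβi := hsq β ⟨1 / 2, I / 2, fun z => by rw [hβ]; ring⟩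
  refine ⟨by have := hαi.re; simpa only [RCLike.re_to_complex, Complex.ofReal_re] using this, ?_⟩
  have h3 : ∫ z, (((‖α z‖ ^ 2 : ℝ) : ℂ) - ((‖β z‖ ^ 2 : ℝ) : ℂ)) = 0 := by
    simp only [hdiff]
    rw [integral_const_mul, integral_sub (hintm I 1) (hintm 1 I), hcross, sub_self, mul_zero]
  rw [integral_sub hαi hβi, integral_complex_ofReal, integral_complex_ofReal, sub_eq_zero] at h3
  exact_mod_cast h3

/-- Twice differentiable functions which decay at infinity like the Cauchy kernel, together with
their first two derivatives. -/
structure HasCauchyDecay (F : ℂ → ℂ) : Prop where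
  contDiff : ContDiff ℝ 2 F
  isBigO : F =O[Filter.cocompact ℂ] fun z => (1 + ‖z‖) ^ (-1 : ℝ)
  isBigO_fderiv : (fderiv ℝ F) =O[Filter.cocompact ℂ] fun z => (1 + ‖z‖) ^ (-2 : ℝ)
  isBigO_fderiv_fderiv :
    (fderiv ℝ (fderiv ℝ F)) =O[Filter.cocompact ℂ] fun z => (1 + ‖z‖) ^ (-2 : ℝ)

lemma HasCauchyDecay.zero : HasCauchyDecay 0 where
  contDiff := contDiff_const
  isBigO := Asymptotics.isBigO_zero _ _
  isBigO_fderiv := by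
    rw [fderiv_zero]; exact Asymptotics.isBigO_zero (E' := ℂ →L[ℝ] ℂ) _ _
  isBigO_fderiv_fderiv := by
    rw [fderiv_zero, fderiv_zero]; exact Asymptotics.isBigO_zero (E' := ℂ →L[ℝ] ℂ →L[ℝ] ℂ) _ _

lemma HasCauchyDecay.add {F G : ℂ → ℂ} (hF : HasCauchyDecay F) (hG : HasCauchyDecay G) :
    HasCauchyDecay (F + G) := by
  have h1 : fderiv ℝ (F + G) = fderiv ℝ F + fderiv ℝ G := funext fun z =>
    fderiv_add (hF.contDiff.differentiable two_ne_zero z)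
      (hG.contDiff.differentiable two_ne_zero z)
  have hF1 : ContDiff ℝ 1 (fderiv ℝ F) := hF.contDiff.fderiv_right (by norm_num)
  have hG1 : ContDiff ℝ 1 (fderiv ℝ G) := hG.contDiff.fderiv_right (by norm_num)
  have h2 : fderiv ℝ (fderiv ℝ F + fderiv ℝ G) = fderiv ℝ (fderiv ℝ F) + fderiv ℝ (fderiv ℝ G) :=
    funext fun z => fderiv_add (hF1.differentiable one_ne_zero z)
      (hG1.differentiable one_ne_zero z)
  refine ⟨hF.contDiff.add hG.contDiff, hF.isBigO.add hG.isBigO, ?_, ?_⟩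
  · rw [h1]; exact Asymptotics.IsBigO.add (E' := ℂ →L[ℝ] ℂ) hF.isBigO_fderiv hG.isBigO_fderiv
  · rw [h1, h2]; exact Asymptotics.IsBigO.add (E' := ℂ →L[ℝ] ℂ →L[ℝ] ℂ) hF.isBigO_fderiv_fderiv
      hG.isBigO_fderiv_fderiv

lemma hasCauchyDecay_of_eq_div {F : ℂ → ℂ} (hF : ContDiff ℝ 2 F) {a c : ℂ} {R : ℝ}
    (h : ∀ z, R < ‖z - c‖ → F z = a / (z - c)) : HasCauchyDecay F := by
  have hT : ∀ w : ℂ, ‖ContinuousLinearMap.mul ℝ ℂ w‖ ≤ ‖w‖ := fun w =>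
    ContinuousLinearMap.opNorm_mul_apply_le ℝ ℂ w
  set R' := max R 0
  have hpos : ∀ z, R' < ‖z - c‖ → z - c ≠ 0 := fun z hz h0 => by
    rw [h0, norm_zero] at hz; exact absurd hz (le_max_right _ _).not_gt
  have hopen : IsOpen {z : ℂ | R' < ‖z - c‖} :=
    isOpen_lt continuous_const (by fun_prop)
  have hd : ∀ (g : ℂ → ℂ) (g' z : ℂ), HasDerivAt g g' z →
      HasFDerivAt g (ContinuousLinearMap.mul ℝ ℂ g') z := by
    intro g g' z hg
    refine (hg.hasFDerivAt.restrictScalars ℝ).congr_fderiv ?_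
    ext; simp [mul_comm]
  have h1 : ∀ z, R' < ‖z - c‖ →
      fderiv ℝ F z = ContinuousLinearMap.mul ℝ ℂ (-a / (z - c) ^ 2) := by
    intro z hz
    have hz0 := hpos z hz
    have hev : F =ᶠ[𝓝 z] fun w => a / (w - c) := by
      filter_upwards [hopen.mem_nhds hz] with w hw
      exact h w ((le_max_left _ _).trans_lt hw)
    rw [hev.fderiv_eq]
    refine (hd _ _ _ ?_).fderiv
    exact ((hasDerivAt_const z a).fun_div ((hasDerivAt_id' z).sub_const c) hz0).congr_deriv
      (by ring)
  have h2 : ∀ z, R' < ‖z - c‖ → fderiv ℝ (fderiv ℝ F) z =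
      (ContinuousLinearMap.mul ℝ ℂ).comp (ContinuousLinearMap.mul ℝ ℂ (2 * a / (z - c) ^ 3)) := by
    intro z hz
    have hz0 := hpos z hz
    have hev : fderiv ℝ F =ᶠ[𝓝 z] fun w => ContinuousLinearMap.mul ℝ ℂ (-a / (w - c) ^ 2) := by
      filter_upwards [hopen.mem_nhds hz] with w hw
      exact h1 w hw
    rw [hev.fderiv_eq]
    refine ((ContinuousLinearMap.mul ℝ ℂ).hasFDerivAt.comp z (hd _ _ _ ?_)).fderiv
    refine ((hasDerivAt_const z (-a)).fun_div (((hasDerivAt_id' z).sub_const c).fun_pow 2)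
      (pow_ne_zero 2 hz0)).congr_deriv ?_
    field_simp
    push_cast
    ring
  have hev : ∀ᶠ z in Filter.cocompact ℂ, R' < ‖z - c‖ ∧ 1 ≤ ‖z - c‖ ∧
      (1 + ‖z‖) / 4 ≤ ‖z - c‖ := by
    filter_upwards [(tendsto_norm_cocompact_atTop (E := ℂ)).eventually_gt_atTop
      (R' + 2 * ‖c‖ + 2)] with z hz
    have h3 : ‖z‖ ≤ ‖z - c‖ + ‖c‖ := by simpa using norm_add_le (z - c) c
    have h4 : 0 ≤ R' := le_max_right _ _
    have h5 := norm_nonneg c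
    refine ⟨by linarith, by linarith, by linarith⟩
  have hb : ∀ᶠ z in Filter.cocompact ℂ, R' < ‖z - c‖ ∧ ‖z - c‖⁻¹ ≤ 1 ∧
      ‖z - c‖⁻¹ ≤ 4 * (1 + ‖z‖)⁻¹ := by
    filter_upwards [hev] with z ⟨hz1, hz2, hz3⟩
    refine ⟨hz1, inv_le_one_of_one_le₀ hz2, ?_⟩
    have : 0 < 1 + ‖z‖ := by positivity
    calc ‖z - c‖⁻¹ ≤ ((1 + ‖z‖) / 4)⁻¹ := inv_anti₀ (by positivity) hz3
      _ = _ := by rw [inv_div]; rfl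
  have hr1 : ∀ z : ℂ, ‖(1 + ‖z‖) ^ (-1 : ℝ)‖ = (1 + ‖z‖)⁻¹ := fun z => by
    rw [Real.rpow_neg_one, norm_inv, Real.norm_of_nonneg (by positivity)]
  have hr2 : ∀ z : ℂ, ‖(1 + ‖z‖) ^ (-2 : ℝ)‖ = (1 + ‖z‖)⁻¹ ^ 2 := fun z => by
    rw [Real.rpow_neg (by positivity), Real.rpow_two, norm_inv,
      Real.norm_of_nonneg (by positivity), inv_pow]
  refine ⟨hF, .of_bound (‖a‖ * 4) ?_, .of_bound (‖a‖ * 16) ?_, .of_bound (2 * ‖a‖ * 16) ?_⟩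
  · filter_upwards [hb] with z ⟨hz1, hz2, hz3⟩
    rw [h z ((le_max_left _ _).trans_lt hz1), hr1, div_eq_mul_inv, norm_mul, norm_inv, mul_assoc]
    gcongr
  · filter_upwards [hb] with z ⟨hz1, hz2, hz3⟩
    rw [h1 z hz1, hr2]
    refine (hT _).trans ?_
    rw [div_eq_mul_inv, norm_mul, norm_inv, norm_neg, norm_pow, ← inv_pow, mul_assoc]
    gcongr
    calc ‖z - c‖⁻¹ ^ 2 ≤ (4 * (1 + ‖z‖)⁻¹) ^ 2 := by gcongr
      _ = _ := by ring
  · filter_upwards [hb] with z ⟨hz1, hz2, hz3⟩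
    rw [h2 z hz1, hr2]
    have hn : ‖(ContinuousLinearMap.mul ℝ ℂ).comp
        (ContinuousLinearMap.mul ℝ ℂ (2 * a / (z - c) ^ 3))‖ ≤ 1 * ‖2 * a / (z - c) ^ 3‖ := by
      refine (ContinuousLinearMap.opNorm_comp_le _ _).trans ?_
      gcongr
      · exact ContinuousLinearMap.opNorm_mul_le ℝ ℂ
      · exact hT _
    refine hn.trans ?_
    rw [one_mul, div_eq_mul_inv, norm_mul, norm_inv, norm_mul, norm_pow, ← inv_pow, mul_assoc,
      mul_assoc, mul_assoc, Complex.norm_ofNat, pow_succ]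
    refine mul_le_mul_of_nonneg_left (mul_le_mul_of_nonneg_left ?_ (norm_nonneg _)) zero_le_two
    calc ‖z - c‖⁻¹ ^ 2 * ‖z - c‖⁻¹ ≤ (4 * (1 + ‖z‖)⁻¹) ^ 2 * 1 := by gcongr
      _ = _ := by ring

/-- A bounded open subset of the plane is filled, up to a small proportion of its area, by finitely
many disjoint discs. -/
lemma exists_finset_disjoint_closedBall {V : Set ℂ} (hVo : IsOpen V)
    (hVb : Bornology.IsBounded V) {ε : ℝ} (hε : 0 < ε) (hε1 : ε < 1) (hV : V.Nonempty) :
    ∃ (t : Finset ℂ) (r : ℂ → ℝ), (∀ x ∈ t, 0 < r x ∧ closedBall x (r x) ⊆ V) ∧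
      (t : Set ℂ).PairwiseDisjoint (fun x => closedBall x (r x)) ∧
      (1 - ε) * volume.real V ≤ volume.real (⋃ x ∈ t, closedBall x (r x)) := by
  obtain ⟨t, r, htc, htV, hr, hcov, hdis⟩ := Besicovitch.exists_disjoint_closedBall_covering_ae
    (volume : Measure ℂ) (fun x => {r : ℝ | closedBall x r ⊆ V}) V (fun x hx δ hδ => by
      obtain ⟨ρ, hρ, hρV⟩ := Metric.isOpen_iff.1 hVo x hx
      refine ⟨min ρ δ / 2, ?_, by positivity, by
        have := min_le_right ρ δ; linarith [lt_min hρ hδ]⟩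
      refine (closedBall_subset_ball ?_).trans hρV
      have := min_le_left ρ δ; linarith [lt_min hρ hδ]) (fun _ => 1) (fun _ _ => one_pos)
  have hfin : volume V ≠ ⊤ := hVb.measure_lt_top.ne
  have hpos : 0 < volume V := hVo.measure_pos _ hV
  have hposr : 0 < volume.real V := ENNReal.toReal_pos hpos.ne' hfin
  have hUV : (⋃ x ∈ t, closedBall x (r x)) ⊆ V := iUnion₂_subset fun x hx => (hr x hx).1
  have hUe : volume (⋃ x ∈ t, closedBall x (r x)) = volume V :=
    le_antisymm (measure_mono hUV) (by
      rw [← measure_sdiff_add_inter V (MeasurableSet.biUnion htc fun _ _ => measurableSet_closedBall),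
        hcov, zero_add]
      exact measure_mono inter_subset_right)
  rw [measure_biUnion htc hdis fun _ _ => measurableSet_closedBall] at hUe
  have hlt : ENNReal.ofReal ((1 - ε) * volume.real V) <
      ∑' x : t, volume (closedBall (x : ℂ) (r x)) := by
    rw [hUe, ENNReal.ofReal_lt_iff_lt_toReal (by nlinarith) hfin]
    change _ < volume.real V
    nlinarith
  rw [ENNReal.tsum_eq_iSup_sum, lt_iSup_iff] at hlt
  obtain ⟨u, hu⟩ := hlt
  have hut : ∀ x ∈ u.map (Function.Embedding.subtype (· ∈ t)), x ∈ t := by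
    intro x hx
    obtain ⟨y, -, rfl⟩ := Finset.mem_map.1 hx
    exact y.2
  refine ⟨u.map (Function.Embedding.subtype _), r, fun x hx => ?_, ?_, ?_⟩
  · have := hr x (hut x hx)
    exact ⟨this.2.1, this.1⟩
  · exact hdis.subset fun x hx => hut x hx
  · rw [measureReal_def (μ := volume) (s := ⋃ x ∈ _, _),
      ← ENNReal.ofReal_le_iff_le_toReal (ne_top_of_le_ne_top hfin
      (measure_mono (iUnion₂_subset fun x hx => (hr x (hut x hx)).1)))]
    refine hu.le.trans (le_of_eq ?_)
    rw [measure_biUnion_finset (hdis.subset fun x hx => hut x hx)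
      fun _ _ => measurableSet_closedBall, Finset.sum_map]
    rfl

/-- If no product of two points of `V` is `1`, then the Bergman kernel of `V` at the origin is at
least `1 / π`. -/
lemma exists_holomorphic_of_mul_ne_one {V : Set ℂ} (hVo : IsOpen V) (hVb : Bornology.IsBounded V)
    (h0 : (0 : ℂ) ∈ V) (hV : ∀ ζ ∈ V, ∀ ξ ∈ V, ζ * ξ ≠ 1) {ε : ℝ} (hε : 0 < ε) (hε1 : ε < 1) :
    ∃ h : ℂ → ℂ, DifferentiableOn ℂ h V ∧ ∫⁻ w in V, ‖h w‖ₑ ^ 2 ≤ 1 ∧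
      (1 - ε) / Real.pi ≤ ‖h 0‖ ^ 2 := by
  have hfin : volume V ≠ ⊤ := hVb.measure_lt_top.ne
  have hpos : 0 < volume V := hVo.measure_pos _ ⟨0, h0⟩
  set A := volume.real V with hA
  have hA0 : 0 < A := ENNReal.toReal_pos hpos.ne' hfin
  have hAV : volume V = ENNReal.ofReal A := (ofReal_measureReal hfin).symm
  have hπ := Real.pi_pos
  have hscale : ‖((√A)⁻¹ : ℂ)‖ ^ 2 = A⁻¹ := by
    rw [norm_inv, norm_real, Real.norm_of_nonneg (Real.sqrt_nonneg _), inv_pow,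
      Real.sq_sqrt hA0.le]
  suffices hmain : ∃ h : ℂ → ℂ, DifferentiableOn ℂ h V ∧ ∫⁻ w in V, ‖h w‖ₑ ^ 2 ≤ volume V ∧
      (1 - ε) * A / Real.pi ≤ ‖h 0‖ ^ 2 by
    obtain ⟨h, hd, hi, hh⟩ := hmain
    refine ⟨fun w => ((√A)⁻¹ : ℂ) * h w, hd.const_mul _, ?_, ?_⟩
    · have he : ‖((√A)⁻¹ : ℂ)‖ₑ ^ 2 = ENNReal.ofReal A⁻¹ := by
        rw [← ofReal_norm, ← ENNReal.ofReal_pow (norm_nonneg _), hscale]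
      simp only [enorm_mul, mul_pow]
      rw [lintegral_const_mul' _ _ (by simp), he]
      calc _ ≤ ENNReal.ofReal A⁻¹ * volume V := by gcongr
        _ = 1 := by
          rw [hAV, ← ENNReal.ofReal_mul (by positivity), inv_mul_cancel₀ hA0.ne',
            ENNReal.ofReal_one]
    · rw [norm_mul, mul_pow, hscale]
      calc (1 - ε) / Real.pi = A⁻¹ * ((1 - ε) * A / Real.pi) := by field_simp
        _ ≤ _ := by gcongr
  rcases le_or_gt A Real.pi with hAπ | hAπ
  · refine ⟨fun _ => 1, differentiableOn_const _, by simp, ?_⟩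
    rw [norm_one, one_pow, div_le_one hπ]
    nlinarith
  set δ := ε / 4 with hδ
  obtain ⟨t, r, ht, hdis, hvol⟩ := exists_finset_disjoint_closedBall hVo hVb (ε := δ)
    (by positivity) (by linarith) ⟨0, h0⟩
  have hpot : ∀ x, ∃ (F α β : ℂ → ℂ) (a : ℝ), x ∈ t → ContDiff ℝ 2 F ∧
      (∀ z v, fderiv ℝ F z v = α z * v + β z * (starRingEnd ℂ) v) ∧ (∀ z, ‖β z‖ ≤ 1) ∧
      (∀ z, r x < ‖z‖ → β z = 0 ∧ α z = -a / z ^ 2 ∧ F z = a / z) ∧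
        (1 - δ) * (r x) ^ 2 ≤ a := by
    intro x
    by_cases hx : x ∈ t
    · obtain ⟨F, α, β, a, h⟩ := exists_disc_potential (ht x hx).1 (ε := δ)
        (by positivity) (by linarith)
      exact ⟨F, α, β, a, fun _ => h⟩
    · exact ⟨0, 0, 0, 0, fun h => absurd h hx⟩
  choose F α β a hpot using hpot
  set U := ⋃ x ∈ t, closedBall x (r x) with hU
  have hUV : U ⊆ V := iUnion₂_subset fun x hx => (ht x hx).2
  have htV : ∀ x ∈ t, x ∈ V := fun x hx =>
    (ht x hx).2 (mem_closedBall_self (ht x hx).1.le)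
  have hUm : MeasurableSet U := Finset.measurableSet_biUnion _ fun _ _ => measurableSet_closedBall
  have hUfin : volume U ≠ ⊤ := ne_top_of_le_ne_top hfin (measure_mono hUV)
  have hUvol : volume.real U = Real.pi * ∑ x ∈ t, r x ^ 2 := by
    rw [hU, measureReal_biUnion_finset hdis (fun _ _ => measurableSet_closedBall)
      (fun x _ => (isCompact_closedBall x (r x)).measure_lt_top.ne), Finset.mul_sum]
    refine Finset.sum_congr rfl fun x hx => ?_
    rw [measureReal_def, Complex.volume_closedBall, ENNReal.toReal_mul, ENNReal.toReal_pow,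
      ENNReal.toReal_ofReal (ht x hx).1.le]
    simp [mul_comm]
  have hshift : ∀ x ∈ t, ContDiff ℝ 2 fun z => F x (z - x) := fun x hx =>
    (hpot x hx).1.comp (contDiff_id.sub contDiff_const)
  have hdecay : HasCauchyDecay (∑ x ∈ t, fun z => F x (z - x)) := by
    refine Finset.sum_induction _ _ (fun _ _ => HasCauchyDecay.add) HasCauchyDecay.zero
      fun x hx => hasCauchyDecay_of_eq_div (hshift x hx) (a := a x) (c := x) (R := r x) ?_
    exact fun z hz => ((hpot x hx).2.2.2.1 _ hz).2.2
  have hfd : ∀ z v, fderiv ℝ (∑ x ∈ t, fun z => F x (z - x)) z v =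
      (∑ x ∈ t, α x (z - x)) * v + (∑ x ∈ t, β x (z - x)) * (starRingEnd ℂ) v := by
    intro z v
    rw [fderiv_sum fun x hx => (hshift x hx).differentiable two_ne_zero z,
      _root_.sum_apply, Finset.sum_mul, Finset.sum_mul, ← Finset.sum_add_distrib]
    refine Finset.sum_congr rfl fun x hx => ?_
    rw [fderiv_comp_sub (𝕜 := ℝ) (f := F x) x, (hpot x hx).2.1]
  obtain ⟨hαi, hαβ⟩ := integral_wirtinger_eq hdecay.contDiff hfd hdecay.isBigO
    hdecay.isBigO_fderiv hdecay.isBigO_fderiv_fderiv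
  have hβ : ∀ z, ‖∑ x ∈ t, β x (z - x)‖ ^ 2 ≤ U.indicator (fun _ => (1 : ℝ)) z := by
    intro z
    by_cases hz : z ∈ U
    · rw [indicator_of_mem hz]
      obtain ⟨y, hy, hzy⟩ := mem_iUnion₂.1 hz
      rw [Finset.sum_eq_single_of_mem y hy]
      · exact pow_le_one₀ (norm_nonneg _) ((hpot y hy).2.2.1 _)
      · intro x hx hxy
        refine ((hpot x hx).2.2.2.1 _ ?_).1
        have := disjoint_right.1 (hdis hx hy hxy) hzy
        rwa [mem_closedBall, not_le, dist_eq_norm] at this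
    · rw [indicator_of_notMem hz, Finset.sum_eq_zero]
      · simp
      · intro x hx
        refine ((hpot x hx).2.2.2.1 _ ?_).1
        have : z ∉ closedBall x (r x) := fun h => hz (mem_iUnion₂.2 ⟨x, hx, h⟩)
        rwa [mem_closedBall, not_le, dist_eq_norm] at this
  have hαU : ∫⁻ z, ‖∑ x ∈ t, α x (z - x)‖ₑ ^ 2 ≤ volume V := by
    have h1 : ∀ z, ‖∑ x ∈ t, α x (z - x)‖ₑ ^ 2 =
        ENNReal.ofReal (‖∑ x ∈ t, α x (z - x)‖ ^ 2) := fun z => by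
      rw [← ofReal_norm, ENNReal.ofReal_pow (norm_nonneg _)]
    simp only [h1]
    rw [← ofReal_integral_eq_lintegral_ofReal hαi (.of_forall fun _ => by positivity), hαβ, hAV]
    refine ENNReal.ofReal_le_ofReal ?_
    calc _ ≤ ∫ z, U.indicator (fun _ => (1 : ℝ)) z :=
          integral_mono_of_nonneg (.of_forall fun _ => by positivity)
            ((integrableOn_const hUfin).integrable_indicator hUm) (.of_forall hβ)
      _ = volume.real U := by rw [integral_indicator hUm]; simp
      _ ≤ A := measureReal_mono hUV hfin
  have hne : ∀ x ∈ t, ∀ ζ ∈ V, 1 - x * ζ ≠ 0 := fun x hx ζ hζ h =>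
    hV x (htV x hx) ζ hζ (sub_eq_zero.1 h).symm
  refine ⟨fun ζ => ∑ x ∈ t, a x / (1 - x * ζ) ^ 2, ?_, ?_, ?_⟩
  · refine DifferentiableOn.fun_sum fun x hx => ?_
    refine (differentiableOn_const _).fun_div (by fun_prop) fun ζ hζ => pow_ne_zero 2 (hne x hx ζ hζ)
  · have hV0 : (V \ {0} : Set ℂ) =ᵐ[volume] V := sdiff_null_ae_eq_self (by simp)
    have hV0m : MeasurableSet (V \ {0}) := hVo.measurableSet.diff (measurableSet_singleton 0)
    rw [← setLIntegral_congr hV0]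
    refine le_trans (le_trans (le_of_eq ?_) (setLIntegral_le_lintegral
      ((fun z : ℂ => z⁻¹) '' (V \ {0})) fun z => ‖∑ x ∈ t, α x (z - x)‖ₑ ^ 2)) hαU
    rw [lintegral_image_eq_lintegral_enorm_deriv hV0m
      (fun z hz => hasDerivAt_inv (by simpa using hz.2)) inv_injective.injOn]
    refine setLIntegral_congr_fun hV0m fun ζ hζ => ?_
    have hζ0 : ζ ≠ 0 := by simpa using hζ.2
    simp only
    rw [← mul_pow, ← enorm_mul]
    congr 2
    rw [Finset.mul_sum]
    refine Finset.sum_congr rfl fun x hx => ?_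
    have hxζ := hne x hx ζ hζ.1
    have hout : ζ⁻¹ ∉ closedBall x (r x) := fun h =>
      hV _ ((ht x hx).2 h) ζ hζ.1 (inv_mul_cancel₀ hζ0)
    rw [mem_closedBall, not_le, dist_eq_norm] at hout
    have hsub : ζ⁻¹ - x = (1 - x * ζ) / ζ := by field_simp
    rw [((hpot x hx).2.2.2.1 _ hout).2.1, hsub]
    field_simp
  · have h1 : (1 - δ) ^ 2 * A / Real.pi ≤ ∑ x ∈ t, a x := by
      have h2 : (1 - δ) * ∑ x ∈ t, r x ^ 2 ≤ ∑ x ∈ t, a x := by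
        rw [Finset.mul_sum]
        exact Finset.sum_le_sum fun x hx => (hpot x hx).2.2.2.2
      rw [hUvol] at hvol
      rw [div_le_iff₀ hπ]
      nlinarith
    have h3 : ‖∑ x ∈ t, (a x : ℂ) / (1 - x * 0) ^ 2‖ ^ 2 = (∑ x ∈ t, a x) ^ 2 := by
      simp only [mul_zero, sub_zero, one_pow, div_one]
      rw [← ofReal_sum, norm_real, Real.norm_eq_abs, sq_abs]
    rw [h3]
    calc (1 - ε) * A / Real.pi ≤ ((1 - δ) ^ 2 * A / Real.pi) ^ 2 := ?_
      _ ≤ _ := by gcongr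
    have h4 : 1 - ε ≤ (1 - δ) ^ 4 := by
      have := one_add_mul_le_pow (a := -δ) (by linarith) 4
      simp only [← sub_eq_add_neg] at this
      refine le_trans (le_of_eq ?_) this
      rw [hδ]; ring
    calc (1 - ε) * A / Real.pi ≤ (1 - δ) ^ 4 * A / Real.pi := by gcongr
      _ = (1 - δ) ^ 4 * A / Real.pi * 1 := by ring
      _ ≤ (1 - δ) ^ 4 * A / Real.pi * (A / Real.pi) := by
        gcongr
        rw [one_le_div hπ]; exact hAπ.le
      _ = _ := by ring

lemma exists_holomorphic_of_sqrt {G : Set ℂ} (hGo : IsOpen G) (h0 : (0 : ℂ) ∈ G) {d : ℂ}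
    (hd : d ∉ G) {s : ℂ → ℂ} (hs : ContinuousOn s G) (hsq : ∀ w ∈ G, s w ^ 2 = w - d)
    {ε : ℝ} (hε : 0 < ε) (hε1 : ε < 1) :
    ∃ f : ℂ → ℂ, DifferentiableOn ℂ f G ∧ ∫⁻ w in G, ‖f w‖ₑ ^ 2 ≤ 1 ∧
      (1 - ε) / (16 * Real.pi * ‖d‖ ^ 2) ≤ ‖f 0‖ ^ 2 := by
  have hd0 : d ≠ 0 := fun h => hd (h ▸ h0)
  have hs0 : ∀ w ∈ G, s w ≠ 0 := fun w hw h => by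
    have := hsq w hw
    rw [h, zero_pow two_ne_zero, eq_comm, sub_eq_zero] at this
    exact hd (this ▸ hw)
  have hsd : ∀ w ∈ G, HasDerivAt s (2 * s w)⁻¹ w := by
    intro w hw
    refine HasDerivAt.of_local_left_inverse (f := fun u => u ^ 2 + d)
      (hs.continuousAt (hGo.mem_nhds hw)) ?_ (mul_ne_zero two_ne_zero (hs0 w hw)) ?_
    · simpa using ((hasDerivAt_pow 2 (s w)).add_const d)
    · filter_upwards [hGo.mem_nhds hw] with y hy
      rw [hsq y hy]; ring
  have hne : ∀ w ∈ G, ∀ w' ∈ G, s w + s w' ≠ 0 := by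
    intro w hw w' hw' h
    have h1 : s w = - s w' := eq_neg_of_add_eq_zero_left h
    have h2 := hsq w hw
    rw [h1, neg_sq, hsq w' hw'] at h2
    have h3 : w' = w := by linear_combination h2
    subst h3
    exact hs0 w' hw (by linear_combination h / 2)
  set u := s 0 with hu
  have hu0 : u ≠ 0 := hs0 0 h0
  have hu2 : u ^ 2 = -d := by rw [hu, hsq 0 h0, zero_sub]
  set ψ : ℂ → ℂ := fun w => (s w - u) / (s w + u) with hψ
  set ψ' : ℂ → ℂ := fun w => u / (s w * (s w + u) ^ 2) with hψ'
  have hψd : ∀ w ∈ G, HasDerivAt ψ (ψ' w) w := by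
    intro w hw
    have h1 := hne w hw 0 h0
    have h2 := hs0 w hw
    have h3 : s w + u ≠ 0 := h1
    refine (((hsd w hw).sub_const u).div ((hsd w hw).add_const u) h1).congr_deriv ?_
    simp only [hψ']
    field_simp
    ring
  have hψinj : InjOn ψ G := by
    intro w hw w' hw' h
    have h1 : s w + u ≠ 0 := hne w hw 0 h0
    have h2 : s w' + u ≠ 0 := hne w' hw' 0 h0
    simp only [hψ] at h
    rw [div_eq_div_iff h1 h2] at h
    have h3 : u * (s w - s w') = 0 := by linear_combination h / 2
    have h4 : s w = s w' := by
      rcases mul_eq_zero.1 h3 with h | h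
      · exact absurd h hu0
      · exact sub_eq_zero.1 h
    have h5 := hsq w hw
    rw [h4, hsq w' hw'] at h5
    linear_combination -h5
  have hψ0 : ψ 0 = 0 := by simp [hψ, hu]
  have hψ'0 : ∀ w ∈ G, ψ' w ≠ 0 := fun w hw =>
    div_ne_zero hu0 (mul_ne_zero (hs0 w hw) (pow_ne_zero _ (hne w hw 0 h0)))
  have hψG : IsOpen (ψ '' G) := by
    rw [isOpen_iff_mem_nhds]
    rintro _ ⟨w, hw, rfl⟩
    have hdiff : DifferentiableOn ℂ ψ G := fun z hz =>
      (hψd z hz).differentiableAt.differentiableWithinAt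
    have hst : HasStrictDerivAt ψ (ψ' w) w := by
      have := (hdiff.contDiffOn (n := 1) hGo).contDiffAt (hGo.mem_nhds hw)
      exact this.hasStrictDerivAt' (hψd w hw) one_ne_zero
    rw [← hst.map_nhds_eq (hψ'0 w hw)]
    exact Filter.image_mem_map (hGo.mem_nhds hw)
  have hψb : Bornology.IsBounded (ψ '' G) := by
    have hsst : HasStrictDerivAt s (2 * s 0)⁻¹ 0 := by
      have hdiff : DifferentiableOn ℂ s G := fun z hz =>
        (hsd z hz).differentiableAt.differentiableWithinAt
      exact ((hdiff.contDiffOn (n := 1) hGo).contDiffAt (hGo.mem_nhds h0)).hasStrictDerivAt'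
        (hsd 0 h0) one_ne_zero
    have hmem : s '' G ∈ 𝓝 u := by
      rw [hu, ← hsst.map_nhds_eq (inv_ne_zero (mul_ne_zero two_ne_zero (hs0 0 h0)))]
      exact Filter.image_mem_map (hGo.mem_nhds h0)
    obtain ⟨r, hr, hrb⟩ := Metric.mem_nhds_iff.1 hmem
    refine isBounded_iff_forall_norm_le.2 ⟨1 + 2 * ‖u‖ / r, ?_⟩
    rintro _ ⟨w, hw, rfl⟩
    have h1 : s w + u ≠ 0 := hne w hw 0 h0
    have h2 : r ≤ ‖s w + u‖ := by
      by_contra! h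
      have : -s w ∈ ball u r := by
        rw [mem_ball, dist_eq_norm, ← norm_neg]
        simpa [add_comm] using h
      obtain ⟨w', hw', h'⟩ := hrb this
      exact hne w hw w' hw' (by rw [h']; ring)
    have h3 : ψ w = 1 - 2 * u / (s w + u) := by
      simp only [hψ]; field_simp; ring
    rw [h3]
    refine (norm_sub_le _ _).trans ?_
    rw [norm_one, norm_div, norm_mul, Complex.norm_ofNat]
    gcongr
  have hψ1 : ∀ ζ ∈ ψ '' G, ∀ ξ ∈ ψ '' G, ζ * ξ ≠ 1 := by
    rintro _ ⟨w, hw, rfl⟩ _ ⟨w', hw', rfl⟩ h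
    have h1 : s w + u ≠ 0 := hne w hw 0 h0
    have h2 : s w' + u ≠ 0 := hne w' hw' 0 h0
    simp only [hψ] at h
    rw [div_mul_div_comm, div_eq_one_iff_eq (mul_ne_zero h1 h2)] at h
    have h3 : u * (s w + s w') = 0 := by linear_combination -h / 2
    rcases mul_eq_zero.1 h3 with h | h
    · exact hu0 h
    · exact hne w hw w' hw' h
  obtain ⟨h, hh, hintegral, hh0⟩ := exists_holomorphic_of_mul_ne_one hψG hψb ⟨0, h0, hψ0⟩ hψ1 hε hε1
  have hψ'd : DifferentiableOn ℂ ψ' G := by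
    intro w hw
    have h1 := (hsd w hw).differentiableAt
    exact ((differentiableAt_const u).div (h1.mul ((h1.add_const u).pow 2))
      (mul_ne_zero (hs0 w hw) (pow_ne_zero _ (hne w hw 0 h0)))).differentiableWithinAt
  refine ⟨fun w => ψ' w * h (ψ w), hψ'd.mul (hh.comp (fun z hz =>
      (hψd z hz).differentiableAt.differentiableWithinAt) (mapsTo_image ψ G)), ?_, ?_⟩
  · rw [lintegral_image_eq_lintegral_enorm_deriv hGo.measurableSet hψd hψinj] at hintegral
    simpa only [enorm_mul, mul_pow] using hintegral
  · have h1 : ‖ψ' 0‖ ^ 2 = 1 / (16 * ‖d‖ ^ 2) := by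
      have h2 : ψ' 0 = - (4 * d)⁻¹ := by
        simp only [hψ']
        rw [← hu, show u * (u + u) ^ 2 = u * (4 * u ^ 2) by ring, hu2]
        field_simp
      rw [h2, norm_neg, norm_inv, norm_mul, Complex.norm_ofNat, inv_pow, mul_pow]
      norm_num
    rw [norm_mul, mul_pow, h1, hψ0]
    calc (1 - ε) / (16 * Real.pi * ‖d‖ ^ 2) = 1 / (16 * ‖d‖ ^ 2) * ((1 - ε) / Real.pi) := by
          rw [div_mul_div_comm]; ring_nf
      _ ≤ _ := by gcongr

lemma det_restrictScalars_eq {ι : Type*} [Finite ι] (A : (ι → ℂ) →ₗ[ℂ] (ι → ℂ)) :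
    LinearMap.det (A.restrictScalars ℝ) = ‖LinearMap.det A‖ ^ 2 := by
  rw [LinearMap.det_restrictScalars, Algebra.norm_complex_apply, normSq_eq_norm_sq]

lemma measurePreserving_of_norm_det_eq_one {ι : Type*} [Fintype ι] (A : (ι → ℂ) →ₗ[ℂ] (ι → ℂ))
    (hA : ‖LinearMap.det A‖ = 1) : MeasurePreserving A volume volume := by
  have h := Measure.map_linearMap_addHaar_eq_smul_addHaar (volume : Measure (ι → ℂ))
    (f := A.restrictScalars ℝ) (by simp [det_restrictScalars_eq, hA])
  rw [det_restrictScalars_eq, hA] at h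
  exact ⟨(LinearMap.continuous_of_finiteDimensional A).measurable, by simpa using h⟩

lemma measurePreserving_toLp_pi (n : ℕ) :
    MeasurePreserving (fun c : Fin n → ℂ => (WithLp.toLp 2 c : Cn n)) volume volume := by
  have hc : Continuous fun c : Fin n → ℂ => (WithLp.toLp 2 c : Cn n) := PiLp.continuous_toLp 2 _
  refine ⟨hc.measurable, ?_⟩
  let b : OrthonormalBasis (Σ _ : Fin n, Fin 2) ℝ (Cn n) :=
    Pi.orthonormalBasis fun _ => Complex.orthonormalBasisOneI
  let L : (Fin n → ℂ) ≃L[ℝ] Cn n := (PiLp.continuousLinearEquiv 2 ℝ fun _ : Fin n => ℂ).symm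
  have hL : (fun c : Fin n → ℂ => (WithLp.toLp 2 c : Cn n)) = L := rfl
  rw [hL, ← b.addHaar_eq_volume, eq_comm, Module.Basis.addHaar_eq_iff,
    Measure.map_apply L.continuous.measurable b.toBasis.parallelepiped.isCompact.measurableSet]
  have hpre : L ⁻¹' b.toBasis.parallelepiped =
      univ.pi fun _ => parallelepiped Complex.orthonormalBasisOneI := by
    ext c
    rw [mem_preimage, Module.Basis.coe_parallelepiped, parallelepiped_basis_eq,
      ← OrthonormalBasis.coe_toBasis Complex.orthonormalBasisOneI, parallelepiped_basis_eq]
    simp only [mem_univ_pi, Set.mem_ofPred_eq, Sigma.forall]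
    refine forall_congr' fun i => forall_congr' fun j => ?_
    rw [OrthonormalBasis.coe_toBasis_repr_apply, OrthonormalBasis.coe_toBasis_repr_apply]
    rfl
  rw [hpre, volume_pi_pi]
  simp only [OrthonormalBasis.volume_parallelepiped, Finset.prod_const_one]

/-- Unitary coordinates centred at `z` preserve Lebesgue measure. -/
lemma measurePreserving_add_sum_smul {n : ℕ} (B : OrthonormalBasis (Fin n) ℂ (Cn n)) (z : Cn n) :
    MeasurePreserving (fun c : Fin n → ℂ => z + ∑ j, c j • B j) volume volume := by
  let U : Cn n ≃ₗᵢ[ℝ] Cn n :=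
    { B.repr.symm.toLinearEquiv.restrictScalars ℝ with
      norm_map' := fun x => B.repr.symm.norm_map x }
  have h := (measurePreserving_add_left volume z).comp
    (U.measurePreserving.comp (measurePreserving_toLp_pi n))
  convert h using 1
  funext c
  simp only [Function.comp]
  congr 1
  exact (B.sum_repr_symm (WithLp.toLp 2 c))

/-- The volume of a weighted complex cross-polytope. -/
lemma volume_sum_norm_div_lt_one {n : ℕ} {d : Fin n → ℝ} (hd : ∀ j, 0 < d j) :
    volume {c : Fin n → ℂ | ∑ j, ‖c j‖ / d j < 1} = ENNReal.ofReal
      ((∏ j, d j) ^ 2 * ((2 * Real.pi) ^ n / (Nat.factorial (2 * n) : ℝ))) := by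
  let A : (Fin n → ℂ) →ₗ[ℂ] (Fin n → ℂ) :=
    Matrix.toLin' (Matrix.diagonal fun j => ((d j : ℂ))⁻¹)
  have hAc : ∀ c j, A c j = (d j : ℂ)⁻¹ * c j := fun c j => by
    rw [Matrix.toLin'_apply, Matrix.mulVec_diagonal]
  have hP : 0 < ∏ j, d j := Finset.prod_pos fun j _ => hd j
  have hdet : LinearMap.det (A.restrictScalars ℝ) = ((∏ j, d j) ^ 2)⁻¹ := by
    rw [det_restrictScalars_eq, LinearMap.det_toLin', Matrix.det_diagonal, Finset.prod_inv_distrib,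
      ← ofReal_prod, norm_inv, norm_real, inv_pow, Real.norm_of_nonneg hP.le]
  have hset : {c : Fin n → ℂ | ∑ j, ‖c j‖ / d j < 1} =
      A.restrictScalars ℝ ⁻¹' {c : Fin n → ℂ | ∑ j, ‖c j‖ ^ (1 : ℝ) < 1} := by
    ext c
    simp only [Set.mem_ofPred_eq, mem_preimage, LinearMap.coe_restrictScalars, hAc, Real.rpow_one,
      norm_mul, norm_inv, norm_real, Real.norm_of_nonneg (hd _).le, div_eq_inv_mul]
  have hG3 : Real.Gamma (2 / 1 + 1) = 2 := by
    have := Real.Gamma_nat_eq_factorial 2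
    norm_num at this ⊢
  have hGn : Real.Gamma (2 * (n : ℝ) / 1 + 1) = (Nat.factorial (2 * n) : ℝ) := by
    have := Real.Gamma_nat_eq_factorial (2 * n)
    push_cast at this
    rw [div_one]; exact this
  rw [hset, Measure.addHaar_preimage_linearMap _ (by rw [hdet]; positivity), hdet,
    Complex.volume_sum_rpow_lt_one (Fin n) le_rfl, Fintype.card_fin, hG3, hGn, inv_inv,
    ← ENNReal.ofReal_mul (abs_nonneg _), abs_of_nonneg (by positivity), mul_comm Real.pi]

/-- The sub-mean value inequality for squares of holomorphic functions on circled domains. -/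
lemma enorm_sq_mul_volume_le {n : ℕ} {S : Set (Fin n → ℂ)} (hSo : IsOpen S)
    (hS : ∀ c ∈ S, ∀ t : ℂ, ‖t‖ ≤ 1 → t • c ∈ S) {g : (Fin n → ℂ) → ℂ}
    (hg : DifferentiableOn ℂ g S) :
    ‖g 0‖ₑ ^ 2 * volume S ≤ ∫⁻ c in S, ‖g c‖ₑ ^ 2 := by
  have hπ := Real.two_pi_pos
  have hpt : ∀ c ∈ S, ENNReal.ofReal (2 * Real.pi) * ‖g 0‖ₑ ^ 2 ≤
      ∫⁻ θ in Ioc 0 (2 * Real.pi), ‖g (circleMap 0 1 θ • c)‖ₑ ^ 2 := by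
    intro c hc
    have hd : DifferentiableOn ℂ (fun t : ℂ => g (t • c) ^ 2) (closure (ball 0 |1|)) := by
      rw [abs_one, closure_ball _ one_ne_zero]
      refine (hg.comp (by fun_prop) fun t ht => ?_).fun_pow 2
      exact hS c hc t (by simpa using ht)
    have hav := hd.diffContOnCl.circleAverage
    rw [Real.circleAverage_def, intervalIntegral.integral_of_le hπ.le, zero_smul] at hav
    have h1 : ∫ θ in Ioc 0 (2 * Real.pi), g (circleMap 0 1 θ • c) ^ 2 =
        ((2 * Real.pi : ℝ) : ℂ) * g 0 ^ 2 := by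
      rw [← hav, Complex.real_smul, ← mul_assoc, ← ofReal_mul, mul_inv_cancel₀ hπ.ne', ofReal_one,
        one_mul]
    have h2 : ‖((2 * Real.pi : ℝ) : ℂ) * g 0 ^ 2‖ₑ = ENNReal.ofReal (2 * Real.pi) * ‖g 0‖ₑ ^ 2 := by
      rw [enorm_mul, enorm_pow, ← ofReal_norm ((2 * Real.pi : ℝ) : ℂ), norm_real,
        Real.norm_of_nonneg hπ.le]
    rw [← h2, ← h1]
    refine (enorm_integral_le_lintegral_enorm _).trans (le_of_eq ?_)
    simp only [enorm_pow]
  have hrot : ∀ θ : ℝ, ∫⁻ c in S, ‖g (circleMap 0 1 θ • c)‖ₑ ^ 2 = ∫⁻ c in S, ‖g c‖ₑ ^ 2 := by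
    intro θ
    set a := circleMap 0 1 θ with ha
    have hn : ‖a‖ = 1 := by simp [ha]
    have ha0 : a ≠ 0 := by rw [← norm_ne_zero_iff, hn]; exact one_ne_zero
    have hmp : MeasurePreserving (fun c : Fin n → ℂ => a • c) volume volume :=
      measurePreserving_of_norm_det_eq_one (a • LinearMap.id)
        (by rw [LinearMap.det_smul]; simp [hn])
    have hpre : (fun c : Fin n → ℂ => a • c) ⁻¹' S = S := by
      ext c
      refine ⟨fun h => ?_, fun h => hS c h a hn.le⟩
      have := hS _ h a⁻¹ (by rw [norm_inv, hn, inv_one])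
      simpa [smul_smul, inv_mul_cancel₀ ha0] using this
    have := hmp.setLIntegral_comp_preimage_emb (Homeomorph.smulOfNeZero a ha0).measurableEmbedding
      (fun c => ‖g c‖ₑ ^ 2) S
    rwa [hpre] at this
  have hmeas : AEMeasurable (Function.uncurry fun (c : Fin n → ℂ) (θ : ℝ) =>
      ‖g (circleMap 0 1 θ • c)‖ₑ ^ 2)
      ((volume.restrict S).prod (volume.restrict (Ioc 0 (2 * Real.pi)))) := by
    rw [Measure.prod_restrict]
    refine AEMeasurable.pow_const (ContinuousOn.aemeasurable ?_
      (hSo.measurableSet.prod measurableSet_Ioc)) 2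
    refine ContinuousOn.enorm ?_
    refine hg.continuousOn.comp (t := S) (by fun_prop) ?_
    rintro ⟨c, θ⟩ ⟨hc, -⟩
    exact hS c hc _ (by simp)
  have hmain : ENNReal.ofReal (2 * Real.pi) * (‖g 0‖ₑ ^ 2 * volume S) ≤
      ENNReal.ofReal (2 * Real.pi) * ∫⁻ c in S, ‖g c‖ₑ ^ 2 :=
    calc ENNReal.ofReal (2 * Real.pi) * (‖g 0‖ₑ ^ 2 * volume S)
        = ∫⁻ c in S, ENNReal.ofReal (2 * Real.pi) * ‖g 0‖ₑ ^ 2 := by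
          rw [setLIntegral_const, mul_assoc]
      _ ≤ ∫⁻ c in S, ∫⁻ θ in Ioc 0 (2 * Real.pi), ‖g (circleMap 0 1 θ • c)‖ₑ ^ 2 :=
          setLIntegral_mono' hSo.measurableSet hpt
      _ = ∫⁻ θ in Ioc 0 (2 * Real.pi), ∫⁻ c in S, ‖g (circleMap 0 1 θ • c)‖ₑ ^ 2 :=
          lintegral_lintegral_swap hmeas
      _ = _ := by
          simp only [hrot]
          rw [setLIntegral_const, Real.volume_Ioc, sub_zero, mul_comm]
  exact (ENNReal.mul_le_mul_iff_right (by simpa using Real.pi_pos) ENNReal.ofReal_ne_top).1 hmain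

lemma IsCConvex.lineAcyclic {n : ℕ} {D : Set (Cn n)} (hDo : IsOpen D) (hD : IsCConvex D) :
    LineAcyclic D := by
  refine lineAcyclic_of_isSimplyConnected hDo fun z X hX hne => ?_
  have : cline z X = affineLine z X := by
    ext w
    exact ⟨fun ⟨l, h⟩ => ⟨l, h.symm⟩, fun ⟨l, h⟩ => ⟨l, h.symm⟩⟩
  rw [← this] at hne ⊢
  exact (hD z X hX hne).2

lemma sliceDist_spec {n : ℕ} {D : Set (Cn n)} (hDo : IsOpen D) (hnl : NoComplexLine D) {z : Cn n}
    (hz : z ∈ D) {v : Fin n → Cn n} (hv : Orthonormal ℂ v) (j : Fin n) :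
    0 < sliceDist D z v j ∧ ∀ w ∈ Submodule.span ℂ (v '' {i | j ≤ i}),
      ‖w‖ < sliceDist D z v j → z + w ∈ D := by
  set S := {r : ℝ | 0 < r ∧ ∀ w ∈ Submodule.span ℂ (v '' {i | j ≤ i}), ‖w‖ < r → z + w ∈ D}
  obtain ⟨ε, hε, hεD⟩ := Metric.isOpen_iff.1 hDo z hz
  have hεS : ε ∈ S := ⟨hε, fun w _ hw => hεD (by simpa [mem_ball, dist_eq_norm] using hw)⟩
  have hvj : v j ∈ Submodule.span ℂ (v '' {i | j ≤ i}) :=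
    Submodule.subset_span (mem_image_of_mem v (le_refl j))
  have hbdd : BddAbove S := by
    by_contra hb
    refine hnl ⟨z, v j, hv.ne_zero j, ?_⟩
    rintro _ ⟨l, rfl⟩
    obtain ⟨r, hr, hlr⟩ := not_bddAbove_iff.1 hb ‖l‖
    exact hr.2 _ (Submodule.smul_mem _ _ hvj) (by rwa [norm_smul, hv.norm_eq_one, mul_one])
  refine ⟨hε.trans_le (le_csSup hbdd hεS), fun w hw hlt => ?_⟩
  obtain ⟨r, hr, hwr⟩ := exists_lt_of_lt_csSup ⟨ε, hεS⟩ hlt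
  exact hr.2 w hw hwr

lemma Orthonormal.exists_orthonormalBasis_fin {n : ℕ} {v : Fin n → Cn n} (hv : Orthonormal ℂ v) :
    ∃ B : OrthonormalBasis (Fin n) ℂ (Cn n), ∀ j, B j = v j := by
  obtain ⟨B, hB⟩ := Orthonormal.exists_orthonormalBasis_extension_of_card_eq (𝕜 := ℂ)
    (E := Cn n) (by simp) (v := v) (s := univ) (hv.comp _ Subtype.val_injective)
  exact ⟨B, fun j => hB j (mem_univ j)⟩

/-- A line-acyclic open set containing discs in independent directions contains their complex
cross-polytope. -/
lemma LineAcyclic.add_sum_smul_mem {E : Type*} [NormedAddCommGroup E] [NormedSpace ℂ E]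
    [FiniteDimensional ℂ E] {D : Set E} (hDo : IsOpen D) (hD : LineAcyclic D) {z : E} (hz : z ∈ D)
    {ι : Type*} [Fintype ι] {v : ι → E} {d : ι → ℝ} (hd : ∀ j, 0 < d j)
    (hv : ∀ j, ∀ l : ℂ, ‖l‖ < d j → z + l • v j ∈ D) {c : ι → ℂ} (hc : ∑ j, ‖c j‖ / d j < 1) :
    z + ∑ j, c j • v j ∈ D := by
  by_contra hmem
  obtain ⟨ℓ, hℓ⟩ := hD.exists_apply_ne hDo hmem
  set t : ℂ := ℓ (∑ j, c j • v j) with ht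
  have ht0 : t ≠ 0 := fun h => hℓ z hz (by rw [map_add, ← ht, h, add_zero])
  have hbound : ∀ j, ‖ℓ (v j)‖ ≤ ‖t‖ / d j := by
    intro j
    by_contra! hlt
    have hlt' : ‖t‖ / d j < ‖ℓ (v j)‖ := hlt
    have hpos : 0 < ‖ℓ (v j)‖ := lt_of_le_of_lt (by have := hd j; positivity) hlt'
    have hn0 : ℓ (v j) ≠ 0 := norm_pos_iff.1 hpos
    refine hℓ _ (hv j (t / ℓ (v j)) ?_) ?_
    · rw [norm_div, div_lt_iff₀ hpos, mul_comm]
      exact (div_lt_iff₀ (hd j)).1 hlt'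
    · rw [map_add, map_add, map_smul, smul_eq_mul, div_mul_cancel₀ _ hn0, ht]
  have h1 : ‖t‖ ≤ ‖t‖ * ∑ j, ‖c j‖ / d j := by
    calc ‖t‖ = ‖∑ j, c j * ℓ (v j)‖ := by rw [ht, map_sum]; simp
      _ ≤ ∑ j, ‖c j * ℓ (v j)‖ := norm_sum_le _ _
      _ ≤ ∑ j, ‖t‖ * (‖c j‖ / d j) := by
        refine Finset.sum_le_sum fun j _ => ?_
        rw [norm_mul]
        calc ‖c j‖ * ‖ℓ (v j)‖ ≤ ‖c j‖ * (‖t‖ / d j) := by gcongr; exact hbound j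
          _ = _ := by ring
      _ = _ := by rw [Finset.mul_sum]
  have := norm_pos_iff.2 ht0
  nlinarith

lemma setLIntegral_enorm_sq_le_one_iff {α : Type*} [MeasurableSpace α] {μ : Measure α} {f : α → ℂ}
    (hf : Integrable (fun w => ‖f w‖ ^ 2) μ) :
    ∫⁻ w, ‖f w‖ₑ ^ 2 ∂μ ≤ 1 ↔ ∫ w, ‖f w‖ ^ 2 ∂μ ≤ 1 := by
  have h1 : ∀ w, ‖f w‖ₑ ^ 2 = ENNReal.ofReal (‖f w‖ ^ 2) := fun w => by
    rw [← ofReal_norm, ENNReal.ofReal_pow (norm_nonneg _)]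
  simp only [h1]
  rw [← ofReal_integral_eq_lintegral_ofReal hf (.of_forall fun _ => by positivity),
    ENNReal.ofReal_le_one]

/-- The upper estimate for square-integrable holomorphic functions on a line-acyclic domain. -/
lemma sq_norm_mul_le_of_integral_le_one {n : ℕ} {D : Set (Cn n)} (hDo : IsOpen D)
    (hD : LineAcyclic D) {z : Cn n} (hz : z ∈ D) (B : OrthonormalBasis (Fin n) ℂ (Cn n))
    {d : Fin n → ℝ} (hd : ∀ j, 0 < d j) (hB : ∀ j, ∀ l : ℂ, ‖l‖ < d j → z + l • B j ∈ D)
    {f : Cn n → ℂ} (hf : DifferentiableOn ℂ f D) (hfi : IntegrableOn (fun w => ‖f w‖ ^ 2) D)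
    (hf1 : (∫ w in D, ‖f w‖ ^ 2) ≤ 1) :
    ‖f z‖ ^ 2 * ((∏ j, d j) ^ 2 * ((2 * Real.pi) ^ n / (Nat.factorial (2 * n) : ℝ))) ≤ 1 := by
  set S := {c : Fin n → ℂ | ∑ j, ‖c j‖ / d j < 1} with hSdef
  set Φ : (Fin n → ℂ) → Cn n := fun c => z + ∑ j, c j • B j with hΦ
  have hSo : IsOpen S := isOpen_lt (by fun_prop) continuous_const
  have hSD : MapsTo Φ S D := fun c hc => hD.add_sum_smul_mem hDo hz hd hB hc
  have hSc : ∀ c ∈ S, ∀ t : ℂ, ‖t‖ ≤ 1 → t • c ∈ S := by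
    intro c hc t ht
    have hc' : ∑ j, ‖c j‖ / d j < 1 := hc
    change ∑ j, ‖(t • c) j‖ / d j < 1
    refine lt_of_le_of_lt (Finset.sum_le_sum fun j _ => ?_) hc'
    have := hd j
    rw [Pi.smul_apply, smul_eq_mul, norm_mul]
    gcongr
    exact mul_le_of_le_one_left (norm_nonneg _) ht
  have hΦd : Differentiable ℂ Φ := by fun_prop
  have h1 := enorm_sq_mul_volume_le hSo hSc (hf.comp hΦd.differentiableOn hSD)
  have hmp := measurePreserving_add_sum_smul B z
  have h2 : ∫⁻ c in S, ‖(f ∘ Φ) c‖ₑ ^ 2 ≤ ∫⁻ w in D, ‖f w‖ₑ ^ 2 := by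
    have hinj : Function.Injective Φ := fun c c' h => funext fun j => by
      have := congrArg (fun w => B.repr w j) (add_left_cancel h)
      simpa [Finset.sum_apply, Pi.single_apply] using this
    rw [← hmp.setLIntegral_comp_preimage_emb
      (hΦd.continuous.measurableEmbedding hinj) (fun w => ‖f w‖ₑ ^ 2) D]
    exact lintegral_mono_set hSD
  have h3 := h1.trans (h2.trans ((setLIntegral_enorm_sq_le_one_iff hfi).2 hf1))
  have hz0 : (f ∘ Φ) 0 = f z := by simp [hΦ]
  rw [volume_sum_norm_div_lt_one hd, hz0, ← ofReal_norm, ← ENNReal.ofReal_pow (norm_nonneg _),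
    ← ENNReal.ofReal_mul (by positivity), ENNReal.ofReal_le_one] at h3
  exact h3

lemma exists_supporting_functional {n : ℕ} {D : Set (Cn n)} (hDo : IsOpen D) (hD : LineAcyclic D)
    {z : Cn n} (hz : z ∈ D) {v : Fin n → Cn n} (hv : Orthonormal ℂ v) {d : ℝ} (hd : 0 < d)
    {j : Fin n} (hball : ∀ w ∈ Submodule.span ℂ (v '' {i | j ≤ i}), ‖w‖ < d → z + w ∈ D)
    (ha : z + d • v j ∉ D) :
    ∃ ℓ : Cn n →L[ℂ] ℂ, ℓ (v j) = 1 ∧ (∀ i, j < i → ℓ (v i) = 0) ∧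
      ∀ w ∈ D, ℓ (w - z) ≠ d := by
  obtain ⟨ℓ, hℓ⟩ := hD.exists_apply_ne hDo ha
  have hsm : ℓ (z + d • v j) = ℓ z + d * ℓ (v j) := by
    rw [map_add, ← Complex.coe_smul, map_smul, smul_eq_mul]
  rw [hsm] at hℓ
  set α := ℓ (v j) with hα
  have hα0 : α ≠ 0 := fun h => hℓ z hz (by simp [h])
  have hzero : ∀ i, j < i → ℓ (v i) = 0 := by
    intro i hi
    by_contra hβ
    set β := ℓ (v i) with hβdef
    have hαp := norm_pos_iff.2 hα0
    have hβp := norm_pos_iff.2 hβ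
    set N : ℝ := ‖α‖ ^ 2 + ‖β‖ ^ 2 with hN
    have hNp : 0 < N := by positivity
    set u : Cn n := starRingEnd ℂ α • v j + starRingEnd ℂ β • v i with hu
    have hℓu : ℓ u = N := by
      rw [hu, map_add, map_smul, map_smul, ← hα, ← hβdef, smul_eq_mul, smul_eq_mul,
        Complex.conj_mul', Complex.conj_mul', hN]
      push_cast
      ring
    have hun : ‖u‖ ^ 2 = N := by
      have h0 : inner ℂ (starRingEnd ℂ α • v j) (starRingEnd ℂ β • v i) = 0 := by
        rw [inner_smul_left, inner_smul_right, hv.inner_eq_zero hi.ne]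
        simp
      have := norm_add_sq_eq_norm_sq_add_norm_sq_of_inner_eq_zero _ _ h0
      rw [hu, sq, this, norm_smul, norm_smul, hv.norm_eq_one, hv.norm_eq_one, RCLike.norm_conj,
        RCLike.norm_conj, hN]
      ring
    have huS : u ∈ Submodule.span ℂ (v '' {i | j ≤ i}) :=
      add_mem (Submodule.smul_mem _ _ (Submodule.subset_span ⟨j, le_refl j, rfl⟩))
        (Submodule.smul_mem _ _ (Submodule.subset_span ⟨i, hi.le, rfl⟩))
    refine hℓ _ (hball ((d * α / N : ℂ) • u) (Submodule.smul_mem _ _ huS) ?_) ?_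
    · rw [norm_smul, norm_div, norm_mul, Complex.norm_real, Complex.norm_real,
        Real.norm_of_nonneg hd.le, Real.norm_of_nonneg hNp.le]
      refine lt_of_pow_lt_pow_left₀ 2 hd.le ?_
      rw [mul_pow, hun, div_pow, div_mul_eq_mul_div, div_lt_iff₀ (by positivity)]
      have : ‖α‖ ^ 2 < N := by rw [hN]; linarith [pow_pos hβp 2]
      calc (d * ‖α‖) ^ 2 * N = d ^ 2 * N * ‖α‖ ^ 2 := by ring
        _ < d ^ 2 * N * N := by gcongr
        _ = d ^ 2 * N ^ 2 := by ring
    · have hN0 : (N : ℂ) ≠ 0 := by exact_mod_cast hNp.ne'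
      rw [map_add, map_smul, hℓu, smul_eq_mul, div_mul_cancel₀ _ hN0]
  refine ⟨α⁻¹ • ℓ, by simp [← hα, hα0], fun i hi => by simp [hzero i hi], fun w hw h => hℓ w hw ?_⟩
  rw [smul_apply, smul_eq_mul, map_sub, inv_mul_eq_iff_eq_mul₀ hα0] at h
  linear_combination h

/-- Products of functions of independent coordinates have norm at most one if each factor does. -/
lemma integral_sq_norm_prod_le_one {ι X : Type*} [Fintype ι] [MeasurableSpace X] {μ : Measure X}
    {Θ : X → ι → ℂ} (hΘ : MeasurePreserving Θ μ volume) {D : Set X} (hDm : MeasurableSet D)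
    {G : ι → Set ℂ} (hG : ∀ j, MeasurableSet (G j)) (hDG : ∀ w ∈ D, ∀ j, Θ w j ∈ G j)
    {f : ι → ℂ → ℂ} (hf : ∀ j, IntegrableOn (fun w => ‖f j w‖ ^ 2) (G j))
    (hf1 : ∀ j, (∫ w in G j, ‖f j w‖ ^ 2) ≤ 1) :
    IntegrableOn (fun w => ‖∏ j, f j (Θ w j)‖ ^ 2) D μ ∧
      (∫ w in D, ‖∏ j, f j (Θ w j)‖ ^ 2 ∂μ) ≤ 1 := by
  set φ : ι → ℂ → ℝ := fun j => (G j).indicator fun w => ‖f j w‖ ^ 2 with hφ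
  have hφ0 : ∀ j w, 0 ≤ φ j w := fun j w => indicator_nonneg (fun _ _ => by positivity) w
  have hφi : Integrable (fun y : ι → ℂ => ∏ j, φ j (y j)) :=
    Integrable.fintype_prod fun j => (integrable_indicator_iff (hG j)).2 (hf j)
  have hΘi : Integrable (fun w => ∏ j, φ j (Θ w j)) μ :=
    hΘ.integrable_comp_of_integrable hφi
  have hEq : EqOn (fun w => ∏ j, φ j (Θ w j)) (fun w => ‖∏ j, f j (Θ w j)‖ ^ 2) D := by
    intro w hw
    simp only [norm_prod, ← Finset.prod_pow]
    exact Finset.prod_congr rfl fun j _ => indicator_of_mem (hDG w hw j) _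
  refine ⟨(hΘi.integrableOn (s := D)).congr_fun hEq hDm, ?_⟩
  rw [← setIntegral_congr_fun hDm hEq]
  calc ∫ w in D, ∏ j, φ j (Θ w j) ∂μ ≤ ∫ w, ∏ j, φ j (Θ w j) ∂μ :=
        setIntegral_le_integral hΘi (.of_forall fun w => Finset.prod_nonneg fun j _ => hφ0 _ _)
    _ = ∫ y : ι → ℂ, ∏ j, φ j (y j) := by
        rw [← hΘ.map_eq, integral_map hΘ.measurable.aemeasurable]
        rw [hΘ.map_eq]
        exact hφi.aestronglyMeasurable
    _ = ∏ j, ∫ y, φ j y := integral_fintype_prod_volume_eq_prod _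
    _ ≤ 1 := by
        refine Finset.prod_le_one (fun j _ => integral_nonneg (hφ0 j)) fun j _ => ?_
        rw [hφ, integral_indicator (hG j)]
        exact hf1 j

/-- A unipotent triangular change of unitary coordinates preserves Lebesgue measure. -/
lemma measurePreserving_of_triangular {n : ℕ} (B : OrthonormalBasis (Fin n) ℂ (Cn n)) (z : Cn n)
    {ℓ : Fin n → Cn n →L[ℂ] ℂ} (h1 : ∀ j, ℓ j (B j) = 1) (h0 : ∀ j i, j < i → ℓ j (B i) = 0) :
    MeasurePreserving (fun w j => ℓ j (w - z)) volume volume := by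
  set M : Matrix (Fin n) (Fin n) ℂ := Matrix.of fun j i => ℓ j (B i) with hM
  have hdet : M.det = 1 := by
    rw [Matrix.det_of_isLowerTriangular M fun i j hij => h0 i j hij]
    simp [hM, h1]
  have hΦ := measurePreserving_add_sum_smul B z
  have hT := measurePreserving_of_norm_det_eq_one (Matrix.toLin' M) (by simp [hdet])
  have hcomp : (fun w j => ℓ j (w - z)) ∘ (fun c : Fin n → ℂ => z + ∑ j, c j • B j) =
      Matrix.toLin' M := by
    funext c j
    simp [hM, Matrix.mulVec, dotProduct, mul_comm]
  have hm : Measurable (fun w j => ℓ j (w - z)) := Continuous.measurable (by fun_prop)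
  refine ⟨hm, ?_⟩
  rw [← hΦ.map_eq, Measure.map_map hm hΦ.measurable, hcomp, hT.map_eq]

/-- A one-variable factor of the competitor for the lower estimate. -/
lemma LineAcyclic.exists_holomorphic_factor {n : ℕ} {D : Set (Cn n)} (hDo : IsOpen D)
    (hD : LineAcyclic D) {z : Cn n} (hz : z ∈ D) (ℓ : Cn n →L[ℂ] ℂ) {e : Cn n} (he : ℓ e = 1)
    {d : ℝ} (hd : ∀ w ∈ D, ℓ (w - z) ≠ d) {ε : ℝ} (hε : 0 < ε) (hε1 : ε < 1) :
    ∃ (G : Set ℂ) (f : ℂ → ℂ), IsOpen G ∧ (∀ w ∈ D, ℓ (w - z) ∈ G) ∧ DifferentiableOn ℂ f G ∧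
      IntegrableOn (fun w => ‖f w‖ ^ 2) G ∧ (∫ w in G, ‖f w‖ ^ 2) ≤ 1 ∧
      (1 - ε) / (16 * Real.pi * d ^ 2) ≤ ‖f 0‖ ^ 2 := by
  set D' : Set (Cn n) := (fun w => w + z) ⁻¹' D with hD'
  have hDo' : IsOpen D' := hDo.preimage (by fun_prop)
  have hd' : ∀ w ∈ D', ℓ w ≠ d := fun w hw => by simpa using hd (w + z) hw
  have hGo : IsOpen (ℓ '' D') := by
    refine ContinuousLinearMap.isOpenMap ℓ (fun c => ⟨c • e, by simp [he]⟩) _ hDo'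
  have h0 : (0 : ℂ) ∈ ℓ '' D' := ⟨0, by simpa [hD'] using hz, map_zero ℓ⟩
  have hdG : (d : ℂ) ∉ ℓ '' D' := by
    rintro ⟨w, hw, h⟩
    exact hd' w hw h
  obtain ⟨s, hs, hsq⟩ := (hD.preimage_add z).exists_sqrt hDo' ℓ he hd'
  obtain ⟨f, hf, hf1, hf0⟩ := exists_holomorphic_of_sqrt hGo h0 hdG hs hsq hε hε1
  have hfi : IntegrableOn (fun w => ‖f w‖ ^ 2) (ℓ '' D') := by
    refine ⟨((hf.continuousOn.norm.pow 2).aestronglyMeasurable hGo.measurableSet), ?_⟩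
    have : ∀ w, ‖‖f w‖ ^ 2‖ₑ = ‖f w‖ₑ ^ 2 := fun w => by simp [enorm_pow]
    simp only [HasFiniteIntegral, this]
    exact hf1.trans_lt ENNReal.one_lt_top
  refine ⟨ℓ '' D', f, hGo, fun w hw => ⟨w - z, by simpa [hD'] using hw, rfl⟩, hf, hfi,
    (setLIntegral_enorm_sq_le_one_iff hfi).1 hf1, ?_⟩
  simpa using hf0

/-- The lower estimate: a square-integrable holomorphic function which is large at `z`. -/
lemma exists_le_sq_norm_of_minimalBasis {n : ℕ} {D : Set (Cn n)} (hDo : IsOpen D)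
    (hD : LineAcyclic D) (hnl : NoComplexLine D) {z : Cn n} (hz : z ∈ D) {v : Fin n → Cn n}
    (hv : MinimalBasis D z v) {ε : ℝ} (hε : 0 < ε) (hε1 : ε < 1) :
    ∃ f : Cn n → ℂ, DifferentiableOn ℂ f D ∧ IntegrableOn (fun w => ‖f w‖ ^ 2) D ∧
      (∫ w in D, ‖f w‖ ^ 2) ≤ 1 ∧
      ∏ j, (1 - ε) / (16 * Real.pi * sliceDist D z v j ^ 2) ≤ ‖f z‖ ^ 2 := by
  obtain ⟨B, hB⟩ := hv.1.exists_orthonormalBasis_fin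
  have hs := fun j => sliceDist_spec hDo hnl hz hv.1 j
  choose ℓ h1 h0 hℓ using fun j =>
    exists_supporting_functional hDo hD hz hv.1 (hs j).1 (hs j).2 (hv.2 j)
  choose G f hGo hDG hf hfi hf1 hf0 using fun j =>
    hD.exists_holomorphic_factor hDo hz (ℓ j) (h1 j) (hℓ j) hε hε1
  have hΘ : MeasurePreserving (fun w j => ℓ j (w - z)) volume volume :=
    measurePreserving_of_triangular B z (fun j => by rw [hB, h1])
      (fun j i hij => by rw [hB, h0 j i hij])
  obtain ⟨hFi, hF1⟩ := integral_sq_norm_prod_le_one hΘ hDo.measurableSet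
    (fun j => (hGo j).measurableSet) (fun w hw j => hDG j w hw) hfi hf1
  refine ⟨fun w => ∏ j, f j (ℓ j (w - z)), ?_, hFi, hF1, ?_⟩
  · have hj : ∀ j, DifferentiableOn ℂ (fun w => f j (ℓ j (w - z))) D := fun j =>
      (hf j).comp (by fun_prop) fun w hw => hDG j w hw
    intro w hw
    classical
    convert (HasFDerivWithinAt.finsetProd (u := Finset.univ)
      fun j _ => (hj j w hw).hasFDerivWithinAt).differentiableWithinAt using 1
  · simp only [sub_self, map_zero, norm_prod, ← Finset.prod_pow]
    refine Finset.prod_le_prod (fun j _ => ?_) fun j _ => hf0 j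
    have : 0 ≤ 1 - ε := by linarith
    positivity

/-- For a ℂ-convex domain `D ⊆ ℂⁿ` containing no complex line and
`z ∈ D`, with `d_{j,D}(z)` from the minimal-distance construction and
`p_D(z) = ∏_j d_{j,D}(z)`, one has `(16π)⁻ⁿ ≤ K_D(z)·p_D(z)² ≤ (2n)!/(2π)ⁿ`. -/
theorem statement13 {n : ℕ} (D : Set (Cn n)) (hD : IsDomain' D) (hcc : IsCConvex D)
    (hnl : NoComplexLine D) (z : Cn n) (hz : z ∈ D)
    (v : Fin n → Cn n) (hv : MinimalBasis D z v) :
    (1 / (16 * Real.pi)) ^ n ≤ bergmanKernel D z * (∏ j, sliceDist D z v j) ^ 2 ∧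
      bergmanKernel D z * (∏ j, sliceDist D z v j) ^ 2 ≤
        (Nat.factorial (2 * n) : ℝ) / (2 * Real.pi) ^ n := by
  have hL : LineAcyclic D := hcc.lineAcyclic hD.1
  have hs := fun j => sliceDist_spec hD.1 hnl hz hv.1 j
  obtain ⟨B, hB⟩ := hv.1.exists_orthonormalBasis_fin
  set d := sliceDist D z v with hd
  set P := ∏ j, d j with hP
  have hPp : 0 < P := Finset.prod_pos fun j _ => (hs j).1
  have hdisc : ∀ j, ∀ l : ℂ, ‖l‖ < d j → z + l • B j ∈ D := fun j l hl => by
    rw [hB]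
    exact (hs j).2 _ (Submodule.smul_mem _ _ (Submodule.subset_span ⟨j, le_refl j, rfl⟩))
      (by rwa [norm_smul, hv.1.norm_eq_one, mul_one])
  set C : ℝ := (2 * Real.pi) ^ n / (Nat.factorial (2 * n) : ℝ) with hC
  have hCp : 0 < C := by
    have := Real.pi_pos
    positivity
  have hub : ∀ r ∈ {r : ℝ | ∃ f : Cn n → ℂ, DifferentiableOn ℂ f D ∧
      IntegrableOn (fun w => ‖f w‖ ^ 2) D ∧ (∫ w in D, ‖f w‖ ^ 2) ≤ 1 ∧ r = ‖f z‖ ^ 2},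
      r ≤ 1 / (P ^ 2 * C) := by
    rintro r ⟨f, hf, hfi, hf1, rfl⟩
    rw [le_div_iff₀ (by positivity)]
    exact sq_norm_mul_le_of_integral_le_one hD.1 hL hz B (fun j => (hs j).1) hdisc hf hfi hf1
  constructor
  · have hlow : ∀ ε : ℝ, 0 < ε → ε < 1 →
        (1 - ε) ^ n * (1 / (16 * Real.pi)) ^ n ≤ bergmanKernel D z * P ^ 2 := by
      intro ε hε hε1
      obtain ⟨f, hf, hfi, hf1, hfz⟩ :=
        exists_le_sq_norm_of_minimalBasis hD.1 hL hnl hz hv hε hε1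
      have hK : ‖f z‖ ^ 2 ≤ bergmanKernel D z := le_csSup ⟨_, hub⟩ ⟨f, hf, hfi, hf1, rfl⟩
      have hprod : ∏ j, (1 - ε) / (16 * Real.pi * d j ^ 2) =
          (1 - ε) ^ n * (1 / (16 * Real.pi)) ^ n / P ^ 2 := by
        simp_rw [div_eq_mul_inv, mul_inv, ← mul_assoc]
        rw [Finset.prod_mul_distrib, Finset.prod_inv_distrib, Finset.prod_pow, ← hP]
        simp [mul_pow, mul_assoc]
      rw [← div_le_iff₀ (by positivity), ← hprod]
      exact hfz.trans hK
    have ht : Filter.Tendsto (fun ε : ℝ => (1 - ε) ^ n * (1 / (16 * Real.pi)) ^ n) (𝓝[>] 0)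
        (𝓝 ((1 / (16 * Real.pi)) ^ n)) := by
      have hc : Continuous fun ε : ℝ => (1 - ε) ^ n * (1 / (16 * Real.pi)) ^ n := by fun_prop
      simpa using (hc.tendsto 0).mono_left nhdsWithin_le_nhds
    refine le_of_tendsto ht ?_
    filter_upwards [Ioo_mem_nhdsGT (zero_lt_one' ℝ)] with ε hε using hlow ε hε.1 hε.2
  · have h := Real.sSup_le hub (by positivity)
    calc bergmanKernel D z * P ^ 2 ≤ 1 / (P ^ 2 * C) * P ^ 2 := by gcongr; exact h
      _ = (Nat.factorial (2 * n) : ℝ) / (2 * Real.pi) ^ n := by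
        rw [hC]
        field_simp

end
end

section
/- Let D ⊆ ℂ^n be a bounded convex domain and a ∈ ∂D. Then a is a peak point with respect to the algebra A(D) if and only if L_a = {0}, i.e. if and only if ∂D contains no nondegenerate disc {a + λX : |λ| < ε} with X ≠ 0. -/
open Complex Metric Set MeasureTheory

noncomputable section

lemma differentiableOn_tsum_of_norm_le {E F ι : Type*} [NormedAddCommGroup E] [NormedSpace ℂ E]
    [NormedAddCommGroup F] [NormedSpace ℂ F] [CompleteSpace F] {f : ι → E → F} {u : ι → ℝ}
    {s : Set E} (hs : IsOpen s) (hu : Summable u) (hf : ∀ i, DifferentiableOn ℂ (f i) s)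
    (hfu : ∀ i, ∀ z ∈ s, ‖f i z‖ ≤ u i) :
    DifferentiableOn ℂ (fun z => ∑' i, f i z) s := by
  intro x hx
  obtain ⟨R, hR, hRs⟩ := Metric.isOpen_iff.1 hs x hx
  have hsub : ∀ y ∈ ball x (R / 2), ball y (R / 2) ⊆ s := fun y hy =>
    (ball_subset_ball' (by linarith [mem_ball.1 hy])).trans hRs
  have hmem : ∀ y ∈ ball x (R / 2), y ∈ s := fun y hy =>
    hsub y hy (mem_ball_self (by positivity))
  refine (hasFDerivAt_tsum_of_isPreconnected (𝕜 := ℂ) (u := fun i => 2 * u i / (R / 2))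
    (f' := fun i y => fderiv ℂ (f i) y) (x₀ := x)
    ((hu.mul_left 2).div_const _) isOpen_ball (convex_ball x (R / 2)).isPreconnected
    (fun i y hy => ((hf i).differentiableAt (hs.mem_nhds (hmem y hy))).hasFDerivAt)
    (fun i y hy => norm_fderiv_le_div_of_mapsTo_ball ((hf i).mono (hsub y hy)) ?_ (by positivity))
    (mem_ball_self (by positivity))
    (Summable.of_norm_bounded hu fun i => hfu i x hx)
    (mem_ball_self (by positivity))).differentiableAt.differentiableWithinAt
  intro z hz
  rw [mem_closedBall, dist_eq_norm]
  linarith [norm_sub_le (f i z) (f i y), hfu i z (hsub y hy hz), hfu i y (hmem y hy)]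

/-- `f` belongs to `A(D)` and peaks exactly on `P ∩ closure D`. -/
structure PeaksOn {E : Type*} [NormedAddCommGroup E] [NormedSpace ℂ E] (D P : Set E)
    (f : E → ℂ) : Prop where
  cont : ContinuousOn f (closure D)
  diff : DifferentiableOn ℂ f D
  eq_one : ∀ z ∈ closure D, z ∈ P → f z = 1
  lt_one : ∀ z ∈ closure D, z ∉ P → ‖f z‖ < 1

lemma exists_pow_mul_le_half {E : Type*} [TopologicalSpace E] {K : Set E} (hK : IsCompact K)
    {f g : E → ℂ} (hf : ContinuousOn f K) (hg : ContinuousOn g K) {c : ℝ}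
    (hfg : ∀ z ∈ K, c ≤ ‖g z‖ → ‖f z‖ < 1) :
    ∃ m : ℕ, m ≠ 0 ∧ ∀ z ∈ K, c ≤ ‖g z‖ → ‖f z ^ m * g z‖ ≤ 1 / 2 := by
  obtain ⟨M, hM⟩ := (hK.image_of_continuousOn hg).isBounded.exists_norm_le
  have hS : IsCompact {z ∈ K | ‖g z‖ ∈ Ici c} := by
    obtain ⟨t, ht, hte⟩ := continuousOn_iff_isClosed.1 hg.norm (Ici c) isClosed_Ici
    have : {z ∈ K | ‖g z‖ ∈ Ici c} = t ∩ K := by rw [← hte]; ext z; simp [and_comm]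
    rw [this]
    exact hK.inter_left ht
  rcases Set.eq_empty_or_nonempty {z ∈ K | ‖g z‖ ∈ Ici c} with he | hne
  · refine ⟨1, one_ne_zero, fun z hz hc => ?_⟩
    exact (he.subset (⟨hz, hc⟩ : z ∈ {z ∈ K | ‖g z‖ ∈ Ici c})).elim
  · obtain ⟨w, hw, hmax⟩ := hS.exists_isMaxOn hne (hf.mono (sep_subset _ _)).norm
    have hr : ‖f w‖ < 1 := hfg w hw.1 hw.2
    have hM0 : 0 ≤ M := (norm_nonneg _).trans (hM _ ⟨w, hw.1, rfl⟩)
    obtain ⟨m, hm⟩ := exists_pow_lt_of_lt_one (show 0 < 1 / (2 * (M + 1)) by positivity) hr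
    refine ⟨m + 1, by simp, fun z hz hc => ?_⟩
    have h1 : ‖f z‖ ≤ ‖f w‖ := hmax ⟨hz, hc⟩
    rw [norm_mul, norm_pow]
    calc ‖f z‖ ^ (m + 1) * ‖g z‖ ≤ ‖f w‖ ^ (m + 1) * M := by
          gcongr
          exact hM _ ⟨z, hz, rfl⟩
      _ ≤ ‖f w‖ ^ m * (M + 1) := by
          gcongr ?_ * ?_
          · exact pow_le_pow_of_le_one (norm_nonneg _) hr.le (Nat.le_succ m)
          · linarith
      _ ≤ 1 / (2 * (M + 1)) * (M + 1) := by gcongr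
      _ = 1 / 2 := by field_simp

lemma hasSum_half_pow_succ : HasSum (fun k : ℕ => (1 / 2 : ℝ) ^ (k + 1)) 1 := by
  convert! hasSum_geometric_two' (1 : ℝ) using 2 with k
  rw [pow_succ, one_div_pow]; ring

lemma tsum_half_pow_mul_lt_one {b : ℕ → ℝ} {G r : ℝ} (hb0 : ∀ k, 0 ≤ b k) (hbG : ∀ k, b k ≤ G)
    (hr : r < 1) (hbr : ∀ k, b k ≤ r * G)
    (hb : ∀ k, 1 + (1 / 2) ^ (k + 2) ≤ G → b k ≤ 1 / 2) :
    ∑' k, (1 / 2 : ℝ) ^ (k + 1) * b k < 1 := by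
  have hs1 := hasSum_half_pow_succ
  have hsb : ∀ c : ℕ → ℝ, ∀ C, (∀ k, 0 ≤ c k) → (∀ k, c k ≤ C) →
      Summable fun k => (1 / 2 : ℝ) ^ (k + 1) * c k := fun c C h0 h =>
    Summable.of_nonneg_of_le (fun k => mul_nonneg (by positivity) (h0 k))
      (fun k => mul_le_mul_of_nonneg_left (h k) (by positivity)) (hs1.summable.mul_right C)
  have hG0 : 0 ≤ G := (hb0 0).trans (hbG 0)
  rcases le_or_gt G 1 with hG | hG
  · have hle : ∀ k, b k ≤ max r 0 := fun k =>
      (hbr k).trans ((mul_le_mul_of_nonneg_right (le_max_left r 0) hG0).trans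
        (mul_le_of_le_one_right (le_max_right r 0) hG))
    calc ∑' k, (1 / 2 : ℝ) ^ (k + 1) * b k ≤ ∑' k : ℕ, (1 / 2 : ℝ) ^ (k + 1) * max r 0 :=
          (hsb b G hb0 hbG).tsum_le_tsum
            (fun k => mul_le_mul_of_nonneg_left (hle k) (by positivity))
            (hs1.summable.mul_right _)
      _ = max r 0 := by rw [tsum_mul_right, hs1.tsum_eq, one_mul]
      _ < 1 := max_lt hr one_pos
  · have hex : ∃ k : ℕ, 1 + (1 / 2 : ℝ) ^ (k + 2) ≤ G := by
      obtain ⟨k, hk⟩ := exists_pow_lt_of_lt_one (sub_pos.2 hG) (by norm_num : (1 / 2 : ℝ) < 1)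
      refine ⟨k, ?_⟩
      have := pow_le_pow_of_le_one (by norm_num : (0 : ℝ) ≤ 1 / 2) (by norm_num)
        (Nat.le_add_right k 2)
      linarith
    classical
    set k := Nat.find hex with hk
    have hlow : ∀ j, k ≤ j → b j ≤ 1 / 2 := fun j hj => hb j <| by
      have := pow_le_pow_of_le_one (by norm_num : (0 : ℝ) ≤ 1 / 2) (by norm_num)
        (Nat.add_le_add_right hj 2)
      linarith [Nat.find_spec hex]
    have hhigh : ∀ j < k, b j ≤ 1 + (1 / 2) ^ (k + 1) := fun j hj => by
      obtain ⟨i, hi⟩ : ∃ i, k = i + 1 := ⟨k - 1, by omega⟩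
      have := not_le.1 (Nat.find_min hex (show i < Nat.find hex by omega))
      rw [hi]
      exact (hbG j).trans this.le
    have hsplit : ∀ k : ℕ, ∑ i ∈ Finset.range k, (1 / 2 : ℝ) ^ (i + 1) = 1 - (1 / 2) ^ k := by
      intro k
      induction k with
      | zero => simp
      | succ k ih => rw [Finset.sum_range_succ, ih]; ring
    have htail : ∑' i : ℕ, (1 / 2 : ℝ) ^ (i + k + 1) = (1 / 2) ^ k := by
      have := hs1.summable.sum_add_tsum_nat_add k
      rw [hsplit, hs1.tsum_eq] at this
      linarith
    have hsum := hsb b G hb0 hbG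
    rw [← hsum.sum_add_tsum_nat_add k]
    have h1 : ∑ i ∈ Finset.range k, (1 / 2 : ℝ) ^ (i + 1) * b i ≤
        (1 - (1 / 2) ^ k) * (1 + (1 / 2) ^ (k + 1)) := by
      rw [← hsplit, Finset.sum_mul]
      exact Finset.sum_le_sum fun i hi =>
        mul_le_mul_of_nonneg_left (hhigh i (Finset.mem_range.1 hi)) (by positivity)
    have h2 : ∑' i, (1 / 2 : ℝ) ^ (i + k + 1) * b (i + k) ≤ (1 / 2) ^ k * (1 / 2) := by
      rw [← htail, ← tsum_mul_right]
      exact ((summable_nat_add_iff k).2 hsum).tsum_le_tsum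
        (fun i => mul_le_mul_of_nonneg_left (hlow _ (Nat.le_add_left k i)) (by positivity))
        (((summable_nat_add_iff k).2 hs1.summable).mul_right _)
    have h3 : (0 : ℝ) < (1 / 2) ^ k := by positivity
    rw [pow_succ] at h1
    nlinarith

/-- If `f` peaks on `P` and `g` peaks on `Q` relative to `P`, then `Q ∩ P` is a peak set. -/
lemma PeaksOn.exists_inter {E : Type*} [NormedAddCommGroup E] [NormedSpace ℂ E] {D P Q : Set E}
    (hD : IsOpen D) (hK : IsCompact (closure D)) {f g : E → ℂ} (hf : PeaksOn D P f)
    (hgc : ContinuousOn g (closure D)) (hgd : DifferentiableOn ℂ g D)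
    (hg1 : ∀ z ∈ closure D, z ∈ P → z ∈ Q → g z = 1)
    (hg : ∀ z ∈ closure D, z ∈ P → z ∉ Q → ‖g z‖ < 1) :
    ∃ h, PeaksOn D (P ∩ Q) h := by
  obtain ⟨M, hM⟩ := (hK.image_of_continuousOn hgc).isBounded.exists_norm_le
  have hM : ∀ z ∈ closure D, ‖g z‖ ≤ M := fun z hz => hM _ ⟨z, hz, rfl⟩
  have hgP : ∀ z ∈ closure D, z ∈ P → ‖g z‖ ≤ 1 := fun z hz hzP => by
    by_cases hzQ : z ∈ Q
    · simp [hg1 z hz hzP hzQ]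
    · exact (hg z hz hzP hzQ).le
  have hf1 : ∀ z ∈ closure D, ‖f z‖ ≤ 1 := fun z hz => by
    by_cases hzP : z ∈ P
    · simp [hf.eq_one z hz hzP]
    · exact (hf.lt_one z hz hzP).le
  have hex : ∀ k : ℕ, ∃ m : ℕ, m ≠ 0 ∧ ∀ z ∈ closure D, 1 + (1 / 2 : ℝ) ^ (k + 2) ≤ ‖g z‖ →
      ‖f z ^ m * g z‖ ≤ 1 / 2 := fun k =>
    exists_pow_mul_le_half hK hf.cont hgc fun z hz hc => hf.lt_one z hz fun hzP => by
      have : (0 : ℝ) < (1 / 2) ^ (k + 2) := by positivity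
      linarith [hgP z hz hzP]
  choose m hm0 hm using hex
  have hs1 := hasSum_half_pow_succ
  have hnorm : ∀ k z, ‖(1 / 2 : ℂ) ^ (k + 1) * (f z ^ m k * g z)‖ =
      (1 / 2 : ℝ) ^ (k + 1) * ‖f z ^ m k * g z‖ := fun k z => by
    rw [norm_mul, norm_pow]; norm_num
  have hle : ∀ k, ∀ z ∈ closure D, ‖f z ^ m k * g z‖ ≤ ‖g z‖ := fun k z hz => by
    rw [norm_mul, norm_pow]
    exact mul_le_of_le_one_left (norm_nonneg _) (pow_le_one₀ (norm_nonneg _) (hf1 z hz))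
  have hbound : ∀ k, ∀ z ∈ closure D, ‖(1 / 2 : ℂ) ^ (k + 1) * (f z ^ m k * g z)‖ ≤
      (1 / 2 : ℝ) ^ (k + 1) * M := fun k z hz => by
    rw [hnorm]
    exact mul_le_mul_of_nonneg_left ((hle k z hz).trans (hM z hz)) (by positivity)
  have hsum := hs1.summable.mul_right M
  have hval : ∀ z ∈ closure D, z ∈ P →
      ∑' k, (1 / 2 : ℂ) ^ (k + 1) * (f z ^ m k * g z) = g z := fun z hz hzP => by
    have : HasSum (fun k : ℕ => (1 / 2 : ℂ) ^ (k + 1)) 1 := by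
      have := Complex.hasSum_ofReal.2 hs1
      push_cast at this
      exact this
    simp only [hf.eq_one z hz hzP, one_pow, one_mul, tsum_mul_right, this.tsum_eq]
  refine ⟨fun z => ∑' k, (1 / 2 : ℂ) ^ (k + 1) * (f z ^ m k * g z), ?_, ?_, ?_, ?_⟩
  · exact continuousOn_tsum
      (fun k => continuousOn_const.mul ((hf.cont.pow _).mul hgc)) hsum
      hbound
  · exact differentiableOn_tsum_of_norm_le hD hsum
      (fun k => ((hf.diff.pow _).mul hgd).const_mul _)
      (fun k z hz => hbound k z (subset_closure hz))
  · rintro z hz ⟨hzP, hzQ⟩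
    exact (hval z hz hzP).trans (hg1 z hz hzP hzQ)
  · intro z hz hzPQ
    by_cases hzP : z ∈ P
    · rw [hval z hz hzP]
      exact hg z hz hzP fun hzQ => hzPQ ⟨hzP, hzQ⟩
    · have hns : Summable fun k => ‖(1 / 2 : ℂ) ^ (k + 1) * (f z ^ m k * g z)‖ :=
        Summable.of_nonneg_of_le (fun _ => norm_nonneg _) (fun k => hbound k z hz) hsum
      refine (norm_tsum_le_tsum_norm hns).trans_lt ?_
      simp only [hnorm]
      refine tsum_half_pow_mul_lt_one (fun _ => norm_nonneg _) (fun k => hle k z hz)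
        (hf.lt_one z hz hzP) (fun k => ?_) (fun k hk => hm k z hz hk)
      rw [norm_mul, norm_pow]
      gcongr
      exact pow_le_of_le_one (norm_nonneg _) (hf1 z hz) (hm0 k)

lemma Convex.exists_ne_zero_re_nonpos {F : Type*} [NormedAddCommGroup F] [NormedSpace ℂ F]
    [NormedSpace ℝ F] [IsScalarTower ℝ ℂ F] [FiniteDimensional ℝ F] {C : Set F}
    (hC : Convex ℝ C) (h0 : 0 ∈ C) (hi : 0 ∉ interior C) :
    ∃ l : F →ₗ[ℂ] ℂ, l ≠ 0 ∧ ∀ x ∈ C, (l x).re ≤ 0 := by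
  by_cases hne : (interior C).Nonempty
  · obtain ⟨l, hl, h⟩ :=
      RCLike.geometric_hahn_banach_of_nonempty_interior_point (𝕜 := ℂ) hC hi hne
    refine ⟨l, fun h0 => hl (ContinuousLinearMap.coe_injective h0), fun x hx => ?_⟩
    simpa using h x hx
  · have hspan : Submodule.span ℝ C < ⊤ := by
      rw [lt_top_iff_ne_top]
      intro htop
      apply hne
      rw [hC.interior_nonempty_iff_affineSpan_eq_top,
        AffineSubspace.affineSpan_eq_top_iff_vectorSpan_eq_top_of_nonempty _ _ _ ⟨0, h0⟩,
        vectorSpan_eq_span_vsub_set_right ℝ h0]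
      simpa using htop
    obtain ⟨r, hr, hker⟩ := Submodule.exists_le_ker_of_lt_top _ hspan
    refine ⟨Module.Dual.extendRCLike (𝕜 := ℂ) r, fun h0 => hr ?_, fun x hx => ?_⟩
    · ext x
      rw [← Module.Dual.re_extendRCLike_apply (𝕜 := ℂ) r x, h0]
      simp
    · have : r x = 0 := hker (Submodule.subset_span hx)
      exact ((Module.Dual.re_extendRCLike_apply (𝕜 := ℂ) r x).trans this).le

lemma norm_exp_add_mul_sq_lt_one {u : ℂ} {c : ℝ} (hc : 0 < c) (hcu : c * ‖u‖ < 1)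
    (hre : u.re ≤ 0) (hu : u ≠ 0) : ‖Complex.exp (u + c * u ^ 2)‖ < 1 := by
  rw [Complex.norm_exp, Real.exp_lt_one_iff]
  have h1 := (abs_le.1 (Complex.abs_re_le_norm u)).1
  have h2 : (u + c * u ^ 2).re = u.re * (1 + c * u.re) - c * u.im ^ 2 := by
    simp [pow_two]; ring
  rw [h2]
  have h3 : 0 < 1 + c * u.re := by nlinarith
  rcases hre.lt_or_eq with h | h
  · nlinarith [mul_pos (neg_pos.2 h) h3, mul_nonneg hc.le (sq_nonneg u.im)]
  · have : u.im ≠ 0 := fun h' => hu (Complex.ext h h')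
    rw [h]
    have : 0 < c * u.im ^ 2 := by positivity
    linarith

/-- A small complex disc around a boundary point, contained in the closure of an open convex set,
lies in the boundary. -/
lemma mem_La_of_forall_mem_closure {n : ℕ} {D : Set (Cn n)} (hD : IsOpen D) (hconv : Convex ℝ D)
    {a X : Cn n} (ha : a ∈ frontier D) {ε : ℝ} (hε : 0 < ε)
    (h : ∀ l : ℂ, ‖l‖ < ε → a + l • X ∈ closure D) : X ∈ La D a := by
  rw [hD.frontier_eq] at ha
  refine ⟨ε, hε, fun l hl => ?_⟩
  rw [hD.frontier_eq]
  refine ⟨h l hl, fun hlD => ha.2 ?_⟩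
  have h2 := h (-l) (by simpa using hl)
  have h3 := hconv.combo_interior_closure_mem_interior (by rwa [hD.interior_eq]) h2
    (a := 1 / 2) (b := 1 / 2) (by norm_num) (by norm_num) (by norm_num)
  rw [hD.interior_eq] at h3
  convert h3 using 1
  rw [← smul_add, neg_smul, add_add_add_comm, add_neg_cancel, add_zero, ← two_smul ℝ a, smul_smul]
  norm_num

/-- A point with trivial `L_a` that is contained in a peak set cut out by a nontrivial complex
affine subspace is contained in one cut out by a smaller subspace. -/
lemma PeaksOn.exists_lt {n : ℕ} {D : Set (Cn n)} (hD : IsOpen D) (hb : Bornology.IsBounded D)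
    (hconv : Convex ℝ D) {a : Cn n} (ha : a ∈ frontier D) (hL : La D a = {0})
    {V : Submodule ℂ (Cn n)} (hV : V ≠ ⊥) {f : Cn n → ℂ} (hf : PeaksOn D {z | z - a ∈ V} f) :
    ∃ W < V, ∃ g, PeaksOn D {z | z - a ∈ W} g := by
  have hK : IsCompact (closure D) := hb.isCompact_closure
  let C : Set V := {v | a + v ∈ closure D}
  have hC : Convex ℝ C := by
    intro v hv w hw s t hs ht hst
    have := hconv.closure hv hw hs ht hst
    change a + ((s • v + t • w : V) : Cn n) ∈ closure D
    convert this using 1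
    rw [smul_add, smul_add, add_add_add_comm, ← add_smul, hst, one_smul]
    rfl
  have h0 : (0 : V) ∈ C := by simpa [C] using frontier_subset_closure ha
  have hi : (0 : V) ∉ interior C := by
    intro hi
    obtain ⟨X, hX, hX0⟩ := Submodule.exists_mem_ne_zero_of_ne_bot hV
    have hcont : Continuous fun l : ℂ => l • (⟨X, hX⟩ : V) := by fun_prop
    have hev := hcont.continuousAt.preimage_mem_nhds (x := (0 : ℂ))
      (by simpa using mem_interior_iff_mem_nhds.1 hi)
    obtain ⟨ε, hε, hball⟩ := Metric.mem_nhds_iff.1 hev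
    have : X ∈ La D a := mem_La_of_forall_mem_closure hD hconv ha hε fun l hl =>
      hball (mem_ball_zero_iff.2 hl)
    rw [hL] at this
    exact hX0 this
  obtain ⟨l, hl0, hl⟩ := hC.exists_ne_zero_re_nonpos h0 hi
  obtain ⟨L, hLl⟩ := l.exists_extend
  have hLv : ∀ v (hv : v ∈ V), L v = l ⟨v, hv⟩ := fun v hv => by rw [← hLl]; rfl
  have hLdiff : Differentiable ℂ L := (LinearMap.toContinuousLinearMap L).differentiable
  obtain ⟨R, hR⟩ := (hK.image (f := fun z => L (z - a))
    (hLdiff.continuous.comp (continuous_id.sub continuous_const))).isBounded.exists_norm_le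
  set c : ℝ := 1 / (|R| + 1) with hc
  have hgd : Differentiable ℂ fun z => Complex.exp (L (z - a) + c * L (z - a) ^ 2) := by
    have : Differentiable ℂ fun z => L (z - a) := hLdiff.comp (differentiable_id.sub_const a)
    fun_prop
  obtain ⟨h, hh⟩ := hf.exists_inter (Q := {z | L (z - a) = 0}) hD hK
    hgd.continuous.continuousOn hgd.differentiableOn
    (fun z _ _ hz => by
      have : L (z - a) = 0 := hz
      simp only [this]
      simp)
    (fun z hz hzV hz0 => by
      refine norm_exp_add_mul_sq_lt_one (by positivity) ?_ ?_ hz0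
      · rw [hc, one_div_mul_eq_div, div_lt_one (by positivity)]
        linarith [hR _ ⟨z, hz, rfl⟩, le_abs_self R]
      · rw [hLv _ hzV]
        exact hl _ (by simpa [C] using hz))
  refine ⟨V ⊓ LinearMap.ker L, lt_of_le_of_ne inf_le_left fun he => hl0 ?_, h, hh⟩
  ext v
  have : (v : Cn n) ∈ V ⊓ LinearMap.ker L := he.ge v.2
  rw [← hLl]
  exact this.2

lemma exists_peaksOn_singleton {n : ℕ} {D : Set (Cn n)} (hD : IsOpen D)
    (hb : Bornology.IsBounded D) (hconv : Convex ℝ D) {a : Cn n} (ha : a ∈ frontier D)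
    (hL : La D a = {0}) : ∃ f, PeaksOn D {a} f := by
  obtain ⟨V, ⟨f, hf⟩, hmin⟩ := WellFounded.has_min (wellFounded_lt (α := Submodule ℂ (Cn n)))
    {V | ∃ f, PeaksOn D {z | z - a ∈ V} f}
    ⟨⊤, fun _ => 1, continuousOn_const, differentiableOn_const 1, fun _ _ _ => rfl,
      fun z _ hz => (hz (Submodule.mem_top (R := ℂ))).elim⟩
  have hV : V = ⊥ := by
    by_contra hV
    obtain ⟨W, hW, hg⟩ := hf.exists_lt hD hb hconv ha hL hV
    exact hmin W hg hW
  refine ⟨f, ?_⟩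
  convert hf using 1
  ext z
  simp [hV, sub_eq_zero]

lemma PeaksOn.La_subset {n : ℕ} {D : Set (Cn n)} (hD : IsOpen D) (hne : D.Nonempty)
    (hb : Bornology.IsBounded D) (hconv : Convex ℝ D) {a : Cn n} {f : Cn n → ℂ}
    (hf : PeaksOn D {a} f) : La D a ⊆ {0} := by
  rintro X ⟨ε, hε, hX⟩
  by_contra hX0
  have hX0 : X ≠ 0 := hX0
  have hK : IsCompact (closure D) := hb.isCompact_closure
  obtain ⟨p, hp⟩ := hne
  have hdisc : ∀ l ∈ closedBall (0 : ℂ) (ε / 2), a + l • X ∈ closure D := fun l hl =>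
    frontier_subset_closure (hX l (by linarith [mem_closedBall_zero_iff.1 hl]))
  have hcont : ContinuousOn (fun l : ℂ => ‖f (a + l • X)‖) (sphere 0 (ε / 2)) :=
    (hf.cont.comp (by fun_prop) fun l hl => hdisc l (sphere_subset_closedBall hl)).norm
  obtain ⟨l₀, hl₀, hmax⟩ := (isCompact_sphere (0 : ℂ) (ε / 2)).exists_isMaxOn
    (NormedSpace.sphere_nonempty.2 (by positivity)) hcont
  have hl₀0 : l₀ ≠ 0 := fun h => by
    rw [h, mem_sphere_zero_iff_norm, norm_zero] at hl₀
    linarith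
  set c := ‖f (a + l₀ • X)‖
  have hc : c < 1 := hf.lt_one _ (hdisc _ (sphere_subset_closedBall hl₀)) (by simp [hl₀0, hX0])
  obtain ⟨δ, hδ, hfδ⟩ := Metric.uniformContinuousOn_iff.1
    (hK.uniformContinuousOn_of_continuous hf.cont) ((1 - c) / 2) (by linarith)
  have hdiam : ∀ x ∈ closure D, ∀ y ∈ closure D, dist x y ≤ Metric.diam (closure D) :=
    fun x hx y hy => Metric.dist_le_diam_of_mem hK.isBounded hx hy
  set d := Metric.diam (closure D)
  have hd : 0 ≤ d := Metric.diam_nonneg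
  obtain ⟨t, ht0, ht1, htd⟩ : ∃ t : ℝ, 0 < t ∧ t ≤ 1 ∧ t * d < δ := by
    refine ⟨min 1 (δ / (d + 1)), by positivity, min_le_left _ _, ?_⟩
    calc min 1 (δ / (d + 1)) * d ≤ δ / (d + 1) * d := by gcongr; exact min_le_right _ _
      _ < δ / (d + 1) * (d + 1) := by gcongr; linarith
      _ = δ := by field_simp
  let φ : ℂ → Cn n := fun l => (1 - t) • (a + l • X) + t • p
  have hφ : ∀ l ∈ closedBall (0 : ℂ) (ε / 2), φ l ∈ D := fun l hl => by
    have := hconv.combo_closure_interior_mem_interior (hdisc l hl)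
      (by rwa [hD.interior_eq] : p ∈ interior D) (sub_nonneg.2 ht1) ht0 (by ring)
    rwa [hD.interior_eq] at this
  have hclose : ∀ l ∈ closedBall (0 : ℂ) (ε / 2),
      dist (f (φ l)) (f (a + l • X)) < (1 - c) / 2 := fun l hl => by
    refine hfδ _ (subset_closure (hφ l hl)) _ (hdisc l hl) ?_
    have : φ l - (a + l • X) = t • (p - (a + l • X)) := by
      simp only [φ, sub_smul, one_smul, smul_sub]; abel
    rw [dist_eq_norm, this, norm_smul, Real.norm_of_nonneg ht0.le, ← dist_eq_norm]
    exact (mul_le_mul_of_nonneg_left (hdiam _ (subset_closure hp) _ (hdisc l hl)) ht0.le).trans_lt htd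
  have hφd : Differentiable ℂ φ := by
    have : Differentiable ℂ fun l : ℂ => a + l • X := by fun_prop
    exact (this.const_smul (1 - t)).add_const _
  have hdiff : DiffContOnCl ℂ (fun l => f (φ l)) (ball 0 (ε / 2)) :=
    DifferentiableOn.diffContOnCl (hf.diff.comp hφd.differentiableOn fun l hl =>
      hφ l (closure_ball_subset_closedBall hl))
  have hle := Complex.norm_le_of_forall_mem_frontier_norm_le isBounded_ball hdiff
    (C := (1 + c) / 2) (fun l hl => by
      rw [frontier_ball _ (by positivity)] at hl
      have h1 := hclose l (sphere_subset_closedBall hl)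
      have h2 : ‖f (a + l • X)‖ ≤ c := hmax hl
      rw [dist_eq_norm] at h1
      linarith [norm_le_norm_add_norm_sub' (f (φ l)) (f (a + l • X))])
    (subset_closure (mem_ball_self (by positivity) : (0 : ℂ) ∈ ball 0 (ε / 2)))
  have h0 := hclose 0 (mem_closedBall_self (by positivity))
  have hfa : f (a + (0 : ℂ) • X) = 1 :=
    hf.eq_one _ (hdisc 0 (mem_closedBall_self (by positivity))) (by simp)
  rw [hfa, dist_comm, dist_eq_norm] at h0
  have := norm_le_norm_add_norm_sub' (1 : ℂ) (f (φ 0))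
  rw [norm_one] at this
  linarith

/-- Let `D ⊆ ℂⁿ` be a bounded convex domain and `a ∈ ∂D`. Then `a` is a
peak point with respect to `A(D)` (continuous on `closure D`, holomorphic on `D`) if and
only if `L_a = {0}`. -/
theorem statement17 {n : ℕ} (D : Set (Cn n)) (hD : IsDomain' D)
    (hb : Bornology.IsBounded D) (hconv : Convex ℝ D) (a : Cn n) (ha : a ∈ frontier D) :
    (∃ f : Cn n → ℂ, ContinuousOn f (closure D) ∧ DifferentiableOn ℂ f D ∧
        f a = 1 ∧ ∀ z ∈ closure D, z ≠ a → ‖f z‖ < 1) ↔ La D a = {0} := by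
  constructor
  · rintro ⟨f, hfc, hfd, hfa, hf⟩
    refine Subset.antisymm (PeaksOn.La_subset hD.1 hD.2.nonempty hb hconv
      ⟨hfc, hfd, fun z _ hz => mem_singleton_iff.1 hz ▸ hfa, hf⟩) ?_
    rintro X rfl
    exact ⟨1, one_pos, fun l _ => by simpa using ha⟩
  · intro hL
    obtain ⟨f, hf⟩ := exists_peaksOn_singleton hD.1 hb hconv ha hL
    exact ⟨f, hf.cont, hf.diff, hf.eq_one a (frontier_subset_closure ha) rfl, hf.lt_one⟩

end
end
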